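/- Let r ≥ 2 be an integer, let k_1, …, k_r be positive integers, and let x_1, …, x_r be roots of unity with (k_1, x_1) ≠ (1,1), (k_r, x_r) ≠ (1,1) and x_1 x_2 ⋯ x_r ≠ 1. Then Li_{k_1,…,k_r}(x_1,…,x_r) − (−1)^{k_1+⋯+k_r−1} Li_{k_r,…,k_1}(x_r^{−1},…,x_1^{−1}) belongs to the K-subalgebra of ℂ generated by all cyclotomic multiple zeta values of depth at most r − 1. -/

import Mathlib

open Filter Finset

/-- A complex number is a root of unity if some positive power of it equals 1. -/
def IsRootOfUnity (z : ℂ) : Prop := ∃ N : ℕ, 0 < N ∧ z ^ N = 1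

open scoped Classical in
/-- Partial sum `Σ_{0<n_1<⋯<n_r≤N} Π_j x_j^{n_j} (n_j + b_j − 1)^{−k_j}` where the list `K`
consists of the triples `(k_j, x_j, b_j)`. -/
noncomputable def cmhzP (K : List (ℕ × ℂ × ℂ)) (N : ℕ) : ℂ :=
  ∑ n ∈ Finset.univ.filter (fun n : Fin K.length → Fin N => StrictMono n),
    ∏ j : Fin K.length,
      (K.get j).2.1 ^ ((n j : ℕ) + 1) /
        ((((n j : ℕ) + 1 : ℕ) : ℂ) + (K.get j).2.2 - 1) ^ (K.get j).1

/-- Cyclotomic multiple Hurwitz zeta value: the limit of the partial sums `cmhzP`. -/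
noncomputable def cmhz (K : List (ℕ × ℂ × ℂ)) : ℂ := limUnder atTop (cmhzP K)

/-- Cyclotomic multiple zeta value (all Hurwitz parameters equal to 1). -/
noncomputable def cmzv (K : List (ℕ × ℂ)) : ℂ := cmhz (K.map fun p => (p.1, p.2, 1))

/-- Cyclotomic multiple t-value (all Hurwitz parameters equal to 1/2). -/
noncomputable def tval (K : List (ℕ × ℂ)) : ℂ := cmhz (K.map fun p => (p.1, p.2, (1 : ℂ)/2))

/-- Depth-one cyclotomic zeta value `Li_k(x)`. -/
noncomputable def li1 (k : ℕ) (x : ℂ) : ℂ := cmzv [(k, x)]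

/-- Depth-one cyclotomic Hurwitz zeta value `Li_k(x; b)`. -/
noncomputable def lih1 (k : ℕ) (x b : ℂ) : ℂ := cmhz [(k, x, b)]

/-- Depth-one cyclotomic t-value `t_k(x)`. -/
noncomputable def tval1 (k : ℕ) (x : ℂ) : ℂ := tval [(k, x)]

/-- The generalized digamma-type series `φ(s; x) = Σ_{k≥0} x^k/(k+s)`. -/
noncomputable def phiF (s x : ℂ) : ℂ :=
  limUnder atTop (fun N : ℕ => ∑ t ∈ Finset.range (N + 1), x ^ t / ((t : ℂ) + s))

/-- The extended trigonometric function `Φ(s; x) = φ(s; x) − φ(−s; x⁻¹) − 1/s`. -/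
noncomputable def PhiF (s x : ℂ) : ℂ := phiF s x - phiF (-s) x⁻¹ - 1 / s

set_option linter.unusedSimpArgs false
set_option linter.unusedVariables false

/-- The power series `(c + X)⁻¹` (which is `0` for `c = 0`). -/
noncomputable def pinv (c : ℂ) : PowerSeries ℂ := (PowerSeries.C c + PowerSeries.X)⁻¹

lemma pinv_zero : pinv 0 = 0 := by
  unfold pinv
  rw [PowerSeries.inv_eq_zero]; simp

lemma pinv_mul (c : ℂ) (hc : c ≠ 0) : (PowerSeries.C c + PowerSeries.X) * pinv c = 1 := by
  unfold pinv
  apply PowerSeries.mul_inv_cancel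
  simpa using hc

lemma pinv_sub (c d : ℂ) (hc : c ≠ 0) (hd : d ≠ 0) :
    PowerSeries.C (c - d) * (pinv c * pinv d) = pinv d - pinv c := by
  have h1 := pinv_mul c hc
  have h2 := pinv_mul d hd
  rw [map_sub]
  linear_combination (pinv d) * h1 - (pinv c) * h2

/-- residue at point `i` -/
noncomputable def resid {ι : Type} [DecidableEq ι] (s : Finset ι) (a : ι → ℂ) (k : ι → ℕ) (i : ι) : ℂ :=
  if k i = 0 then 0 else
    PowerSeries.coeff (k i - 1) (∏ l ∈ s.erase i, pinv (a i - a l) ^ (k l))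

lemma resid_step {ι : Type} [DecidableEq ι] (s : Finset ι) (a : ι → ℂ) (ha : Set.InjOn a s)
    (k : ι → ℕ) (p q : ι) (hp : p ∈ s) (hq : q ∈ s) (hpq : p ≠ q) (i : ι) (hi : i ∈ s) :
    (a p - a q) * resid s a (k + Pi.single p 1 + Pi.single q 1) i
      = resid s a (k + Pi.single p 1) i - resid s a (k + Pi.single q 1) i := by
  have key : ∀ (p q : ι) (hp : p ∈ s) (hq : q ∈ s) (hpq : p ≠ q),
    (a p - a q) * resid s a (k + Pi.single p 1 + Pi.single q 1) p
      = resid s a (k + Pi.single p 1) p - resid s a (k + Pi.single q 1) p := by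
    intro p q hp hq hpq
    have hne : a p - a q ≠ 0 := sub_ne_zero.2 fun h => hpq (ha hp hq h)
    have hq' : q ∈ s.erase p := by simp [hq, hpq.symm]
    have e1 : ∀ l ∈ (s.erase p).erase q, (k + Pi.single p 1 + Pi.single q 1 : ι → ℕ) l = k l := by
      intro l hl
      simp only [Finset.mem_erase] at hl
      simp [Pi.single_apply, hl.1, hl.2.1]
    have e2 : ∀ l ∈ (s.erase p).erase q, (k + Pi.single p 1 : ι → ℕ) l = k l := by
      intro l hl
      simp only [Finset.mem_erase] at hl
      simp [Pi.single_apply, hl.2.1]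
    have e3 : ∀ l ∈ (s.erase p).erase q, (k + Pi.single q 1 : ι → ℕ) l = k l := by
      intro l hl
      simp only [Finset.mem_erase] at hl
      simp [Pi.single_apply, hl.1]
    set H := ∏ l ∈ (s.erase p).erase q, pinv (a p - a l) ^ (k l) with hH
    have f1 : ∏ l ∈ s.erase p, pinv (a p - a l) ^ ((k + Pi.single p 1 + Pi.single q 1 : ι → ℕ) l)
        = pinv (a p - a q) ^ (k q + 1) * H := by
      rw [← Finset.mul_prod_erase _ _ hq', Finset.prod_congr rfl (fun l hl => by rw [e1 l hl])]
      rw [← hH]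
      simp [hpq, Pi.single_apply, hpq.symm]
    have f2 : ∏ l ∈ s.erase p, pinv (a p - a l) ^ ((k + Pi.single p 1 : ι → ℕ) l)
        = pinv (a p - a q) ^ (k q) * H := by
      rw [← Finset.mul_prod_erase _ _ hq', Finset.prod_congr rfl (fun l hl => by rw [e2 l hl])]
      rw [← hH]
      simp [hpq, Pi.single_apply, hpq.symm]
    have f3 : ∏ l ∈ s.erase p, pinv (a p - a l) ^ ((k + Pi.single q 1 : ι → ℕ) l)
        = pinv (a p - a q) ^ (k q + 1) * H := by
      rw [← Finset.mul_prod_erase _ _ hq', Finset.prod_congr rfl (fun l hl => by rw [e3 l hl])]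
      rw [← hH]
      simp [hpq, Pi.single_apply, hpq.symm]
    unfold resid
    rw [f1, f2, f3]
    have hkp : (k + Pi.single p 1 + Pi.single q 1 : ι → ℕ) p = k p + 1 := by
      simp [Pi.single_apply, hpq]
    have hkp2 : (k + Pi.single p 1 : ι → ℕ) p = k p + 1 := by simp
    have hkp3 : (k + Pi.single q 1 : ι → ℕ) p = k p := by simp [Pi.single_apply, hpq]
    rw [hkp, hkp2, hkp3]
    have hm := pinv_mul _ hne
    have g : pinv (a p - a q) ^ (k q) * H = PowerSeries.C (a p - a q) * (pinv (a p - a q) ^ (k q + 1) * H)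
        + PowerSeries.X * (pinv (a p - a q) ^ (k q + 1) * H) := by
      rw [pow_succ]
      linear_combination (- pinv (a p - a q) ^ (k q) * H) * hm
    rw [g]
    simp only [Nat.add_sub_cancel, Nat.succ_ne_zero, if_false, map_add, PowerSeries.coeff_C_mul]
    rcases hk : k p with _ | m
    · simp
    · simp [PowerSeries.coeff_succ_X_mul]
  by_cases h1 : i = p
  · subst h1; exact key i q hp hq hpq
  by_cases h2 : i = q
  · subst h2
    have := key i p hq hp (Ne.symm hpq)
    rw [add_right_comm] at this
    linear_combination -this
  have hp' : p ∈ s.erase i := by simp [hp, Ne.symm h1]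
  have hq' : q ∈ (s.erase i).erase p := by simp [hq, Ne.symm h2, hpq.symm]
  have hnp : a i - a p ≠ 0 := sub_ne_zero.2 fun h => h1 (ha hi hp h)
  have hnq : a i - a q ≠ 0 := sub_ne_zero.2 fun h => h2 (ha hi hq h)
  set H := ∏ l ∈ ((s.erase i).erase p).erase q, pinv (a i - a l) ^ (k l) with hH
  have gen : ∀ k' : ι → ℕ, (∀ l ∈ ((s.erase i).erase p).erase q, k' l = k l) →
      ∏ l ∈ s.erase i, pinv (a i - a l) ^ (k' l)
        = pinv (a i - a p) ^ (k' p) * (pinv (a i - a q) ^ (k' q) * H) := by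
    intro k' h
    rw [← Finset.mul_prod_erase _ _ hp', ← Finset.mul_prod_erase _ _ hq',
      Finset.prod_congr rfl (fun l hl => by rw [h l hl])]
  unfold resid
  rw [gen, gen, gen]
  · have a1 : (k + Pi.single p 1 + Pi.single q 1 : ι → ℕ) i = k i := by simp [Pi.single_apply, h1, h2]
    have a2 : (k + Pi.single p 1 : ι → ℕ) i = k i := by simp [Pi.single_apply, h1]
    have a3 : (k + Pi.single q 1 : ι → ℕ) i = k i := by simp [Pi.single_apply, h2]
    rw [a1, a2, a3]
    by_cases h0 : k i = 0
    · simp [h0]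
    rw [if_neg h0, if_neg h0, if_neg h0, ← PowerSeries.coeff_C_mul, ← map_sub]
    congr 1
    have := pinv_sub _ _ hnp hnq
    rw [show a i - a p - (a i - a q) = -(a p - a q) by ring, map_neg] at this
    simp [Pi.single_apply, hpq, hpq.symm]
    simp only [map_sub] at this
    linear_combination (- pinv (a i - a p) ^ (k p) * pinv (a i - a q) ^ (k q) * H) * this
  all_goals
    intro l hl
    simp only [Finset.mem_erase] at hl
    simp [Pi.single_apply, hl.1, hl.2.1]

lemma sum_resid_single {ι : Type} [DecidableEq ι] (s : Finset ι) (a : ι → ℂ) (k : ι → ℕ) (p : ι)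
    (hp : p ∈ s) (hk : 0 < k p) (h : ∀ l ∈ s, l ≠ p → k l = 0) :
    ∑ i ∈ s, resid s a k i = if k p = 1 then 1 else 0 := by
  rw [Finset.sum_eq_single p]
  · unfold resid
    rw [if_neg hk.ne', Finset.prod_eq_one, PowerSeries.coeff_one]
    · congr 1
      simp; omega
    · intro l hl
      rw [Finset.mem_erase] at hl
      rw [h l hl.2 hl.1, pow_zero]
  · intro l hl hlp
    simp [resid, h l hl hlp]
  · intro h; exact absurd hp h

lemma sum_resid {ι : Type} [DecidableEq ι] (s : Finset ι) (a : ι → ℂ) (ha : Set.InjOn a s) :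
    ∀ (n : ℕ) (k : ι → ℕ), ∑ i ∈ s, k i = n + 2 → ∑ i ∈ s, resid s a k i = 0 := by
  have dich : ∀ k : ι → ℕ, 0 < ∑ i ∈ s, k i → (∃ p ∈ s, 0 < k p ∧ (∀ l ∈ s, l ≠ p → k l = 0) ∧
      k p = ∑ i ∈ s, k i) ∨ ∃ p ∈ s, ∃ q ∈ s, p ≠ q ∧ ∃ k' : ι → ℕ, k = k' + Pi.single p 1 + Pi.single q 1 ∧
        ∑ i ∈ s, k i = ∑ i ∈ s, k' i + 2 := by
    intro k hk
    obtain ⟨p, hp, hkp⟩ : ∃ p ∈ s, 0 < k p := by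
      by_contra! hcon
      have : ∑ i ∈ s, k i = 0 := Finset.sum_eq_zero fun i hi => by have := hcon i hi; omega
      omega
    by_cases h : ∀ l ∈ s, l ≠ p → k l = 0
    · left
      refine ⟨p, hp, hkp, h, ?_⟩
      rw [Finset.sum_eq_single p h (fun h => absurd hp h)]
    · right
      push Not at h
      obtain ⟨q, hq, hqp, hkq⟩ := h
      have e : k = (k - Pi.single p 1 - Pi.single q 1) + Pi.single p 1 + Pi.single q 1 := by
        funext l
        simp only [Pi.add_apply, Pi.sub_apply, Pi.single_apply]
        by_cases h1 : l = p
        · subst h1; simp [hqp.symm]; omega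
        · by_cases h2 : l = q
          · subst h2; simp [h1]; omega
          · simp [h1, h2]
      refine ⟨p, hp, q, hq, hqp.symm, k - Pi.single p 1 - Pi.single q 1, e, ?_⟩
      conv_lhs => rw [e]
      simp only [Pi.add_apply, Finset.sum_add_distrib, Finset.sum_pi_single', hp, hq, if_true]
  have step : ∀ (k : ι → ℕ) (p q : ι) (hp : p ∈ s) (hq : q ∈ s) (hpq : p ≠ q),
      (a p - a q) * ∑ i ∈ s, resid s a (k + Pi.single p 1 + Pi.single q 1) i
      = ∑ i ∈ s, resid s a (k + Pi.single p 1) i - ∑ i ∈ s, resid s a (k + Pi.single q 1) i := by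
    intro k p q hp hq hpq
    rw [Finset.mul_sum, ← Finset.sum_sub_distrib]
    exact Finset.sum_congr rfl fun i hi => resid_step s a ha k p q hp hq hpq i hi
  intro n
  induction n with
  | zero =>
    intro k hk
    rcases dich k (by omega) with ⟨p, hp, hkp, h, h'⟩ | ⟨p, hp, q, hq, hpq, k', rfl, h'⟩
    · rw [sum_resid_single s a k p hp hkp h, if_neg (by omega)]
    · have hne : a p - a q ≠ 0 := sub_ne_zero.2 fun h => hpq (ha hp hq h)
      have h0 : ∑ i ∈ s, k' i = 0 := by omega
      rw [Finset.sum_eq_zero_iff] at h0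
      have := step k' p q hp hq hpq
      rw [sum_resid_single s a (k' + Pi.single p 1) p hp (by simp)
          (fun l hl hlp => by simp [h0 l hl, hlp]),
        sum_resid_single s a (k' + Pi.single q 1) q hq (by simp)
          (fun l hl hlp => by simp [h0 l hl, hlp]), if_pos (by simp [h0 p hp]),
        if_pos (by simp [h0 q hq]), sub_self] at this
      exact (mul_eq_zero.1 this).resolve_left hne
  | succ n ih =>
    intro k hk
    rcases dich k (by omega) with ⟨p, hp, hkp, h, h'⟩ | ⟨p, hp, q, hq, hpq, k', rfl, h'⟩
    · rw [sum_resid_single s a k p hp hkp h, if_neg (by omega)]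
    · have hne : a p - a q ≠ 0 := sub_ne_zero.2 fun h => hpq (ha hp hq h)
      have := step k' p q hp hq hpq
      rw [ih (k' + Pi.single p 1), ih (k' + Pi.single q 1), sub_self] at this
      · exact (mul_eq_zero.1 this).resolve_left hne
      · simp only [Pi.add_apply, Finset.sum_add_distrib, Finset.sum_pi_single', hp, hq, if_true]
        omega
      · simp only [Pi.add_apply, Finset.sum_add_distrib, Finset.sum_pi_single', hp, hq, if_true]
        omega

/-- The partial fraction identity for distinct points. -/
lemma pf_identity (r : ℕ) (hr : 0 < r) (n : ℕ → ℂ) (hn : Set.InjOn n (Finset.range r : Finset ℕ))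
    (κ : ℕ → ℕ) (hκ : ∀ i < r, 0 < κ i) :
    PowerSeries.coeff 0 (∏ l ∈ range r, pinv (n l) ^ κ l)
    + ∑ j ∈ range r, (if n j = 0 then PowerSeries.coeff (κ j)
        (∏ l ∈ (range r).erase j, pinv (n l - n j) ^ κ l) else 0)
    + ∑ i ∈ range r, PowerSeries.coeff (κ i - 1) (pinv (- n i) *
        ∏ l ∈ (range r).erase i, pinv (n l - n i) ^ κ l) = 0 := by
  have hsum : r ≤ ∑ i ∈ range r, κ i := by
    calc r = ∑ i ∈ range r, 1 := by simp
      _ ≤ _ := Finset.sum_le_sum fun i hi => hκ i (by simpa using hi)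
  by_cases h0 : ∃ j ∈ range r, n j = 0
  · obtain ⟨j, hj, hj0⟩ := h0
    have huniq : ∀ l ∈ range r, l ≠ j → n l ≠ 0 := fun l hl hlj h => hlj (hn hl hj (by rw [h, hj0]))
    have t1 : ∏ l ∈ range r, pinv (n l) ^ κ l = 0 := by
      apply Finset.prod_eq_zero hj
      rw [hj0, pinv_zero, zero_pow (hκ j (by simpa using hj)).ne']
    have t2 : ∑ j ∈ range r, (if n j = 0 then PowerSeries.coeff (κ j)
        (∏ l ∈ (range r).erase j, pinv (n l - n j) ^ κ l) else 0) = PowerSeries.coeff (κ j)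
        (∏ l ∈ (range r).erase j, pinv (n l - n j) ^ κ l) := by
      rw [Finset.sum_eq_single j, if_pos hj0]
      · intro l hl hlj; rw [if_neg (huniq l hl hlj)]
      · intro h; exact absurd hj h
    rw [t1, t2, map_zero, zero_add]
    have ha : Set.InjOn (fun l => - n l) (range r : Finset ℕ) := fun x hx y hy h => hn hx hy (neg_injective h)
    obtain ⟨m, hm⟩ : ∃ m, ∑ i ∈ range r, (κ + Pi.single j 1 : ℕ → ℕ) i = m + 2 := by
      simp only [Pi.add_apply, Finset.sum_add_distrib, Finset.sum_pi_single', hj, if_true]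
      exact ⟨∑ i ∈ range r, κ i - 1, by omega⟩
    have R := sum_resid (range r) (fun l => - n l) ha m (κ + Pi.single j 1) hm
    rw [← Finset.add_sum_erase _ _ hj] at R ⊢
    rw [hj0, neg_zero, pinv_zero, zero_mul, map_zero, zero_add]
    refine Eq.trans ?_ R
    congr 1
    · unfold resid
      rw [if_neg (by simp)]
      simp only [Pi.add_apply, Pi.single_eq_same, Nat.add_sub_cancel, hj0]
      congr 1
      apply Finset.prod_congr rfl
      intro l hl
      rw [Finset.mem_erase] at hl
      simp [hl.1]
    · apply Finset.sum_congr rfl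
      intro i hi
      rw [Finset.mem_erase] at hi
      unfold resid
      have hi' : 0 < κ i := hκ i (by simpa using hi.2)
      rw [if_neg (by simp; omega)]
      simp only [Pi.add_apply, Pi.single_apply, hi.1, if_false, add_zero]
      congr 1
      have hj' : j ∈ (range r).erase i := by simp [Ne.symm hi.1]; simpa using hj
      rw [← Finset.mul_prod_erase _ _ hj', ← Finset.mul_prod_erase _ _ hj', if_pos rfl, hj0, pow_succ]
      have : ∏ l ∈ ((range r).erase i).erase j, pinv (-n i - -n l) ^ (κ l + if l = j then 1 else 0)
        = ∏ l ∈ ((range r).erase i).erase j, pinv (n l - n i) ^ κ l := by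
        apply Finset.prod_congr rfl
        intro l hl
        rw [Finset.mem_erase] at hl
        rw [if_neg hl.1, add_zero]
        congr 2; ring
      rw [this]
      simp only [neg_zero, sub_zero, zero_sub]
      ring
  · push Not at h0
    have t2 : ∑ j ∈ range r, (if n j = 0 then PowerSeries.coeff (κ j)
        (∏ l ∈ (range r).erase j, pinv (n l - n j) ^ κ l) else 0) = 0 := by
      apply Finset.sum_eq_zero
      intro j hj; rw [if_neg (h0 j hj)]
    rw [t2, add_zero]
    set a : ℕ → ℂ := fun l => if l = r then 0 else - n l with hadef
    set k' : ℕ → ℕ := fun l => if l = r then 1 else κ l with hkdef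
    have ar : a r = 0 := by simp [hadef]
    have al : ∀ l ∈ range r, a l = - n l := by
      intro l hl; simp only [Finset.mem_range] at hl; simp [hadef, hl.ne]
    have kr : k' r = 1 := by simp [hkdef]
    have kl : ∀ l ∈ range r, k' l = κ l := by
      intro l hl; simp only [Finset.mem_range] at hl; simp [hkdef, hl.ne]
    have ha : Set.InjOn a (range (r+1) : Finset ℕ) := by
      intro x hx y hy h
      simp only [Finset.coe_range, Set.mem_Iio] at hx hy
      by_cases hxr : x = r
      · by_cases hyr : y = r
        · rw [hxr, hyr]
        · have hy' : y ∈ range r := by simp; omega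
          rw [hxr, ar, al y hy'] at h
          exact absurd (neg_eq_zero.1 h.symm) (h0 y hy')
      · have hx' : x ∈ range r := by simp; omega
        by_cases hyr : y = r
        · rw [hyr, ar, al x hx'] at h
          exact absurd (neg_eq_zero.1 h) (h0 x hx')
        · have hy' : y ∈ range r := by simp; omega
          rw [al x hx', al y hy'] at h
          exact hn hx' hy' (neg_injective h)
    obtain ⟨m, hm⟩ : ∃ m, ∑ i ∈ range (r+1), k' i = m + 2 := by
      have hs : ∑ i ∈ range r, k' i = ∑ i ∈ range r, κ i := Finset.sum_congr rfl kl
      rw [Finset.sum_range_succ, hs, kr]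
      exact ⟨∑ i ∈ range r, κ i - 1, by omega⟩
    have R := sum_resid (range (r+1)) a ha m k' hm
    rw [Finset.sum_range_succ, add_comm] at R
    refine Eq.trans ?_ R
    have er : (range (r+1)).erase r = range r := by
      ext l; simp; omega
    congr 1
    · unfold resid
      rw [kr, if_neg one_ne_zero, er, ar]
      congr 1
      apply Finset.prod_congr rfl
      intro l hl
      rw [al l hl, kl l hl]; simp
    · apply Finset.sum_congr rfl
      intro i hi
      have hi2 := hi
      rw [Finset.mem_range] at hi2
      unfold resid
      rw [kl i hi, if_neg (hκ i hi2).ne']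
      congr 1
      have hr' : r ∈ (range (r+1)).erase i := by simp; omega
      have er2 : ((range (r+1)).erase i).erase r = (range r).erase i := by
        rw [Finset.erase_right_comm, er]
      rw [← Finset.mul_prod_erase _ _ hr', er2, ar, kr, al i hi, pow_one, sub_zero]
      congr 1
      apply Finset.prod_congr rfl
      intro l hl
      rw [Finset.mem_erase] at hl
      rw [al l hl.2, kl l hl.2]
      congr 2; ring

/-- Sum over strictly increasing integer lists of length `r` in the open interval `(a,b)`. -/
noncomputable def NS {M : Type} [AddCommMonoid M] : ℕ → ℤ → ℤ → (List ℤ → M) → M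
  | 0, _, _, F => F []
  | r + 1, a, b, F => ∑ n ∈ Finset.Ioo a b, NS r n b (fun l => F (n :: l))

lemma NS_congr {M : Type} [AddCommMonoid M] (r : ℕ) : ∀ (a b : ℤ) (F G : List ℤ → M),
    (∀ l : List ℤ, l.length = r → l.Pairwise (· < ·) → (∀ n ∈ l, a < n ∧ n < b) → F l = G l) →
    NS r a b F = NS r a b G := by
  induction r with
  | zero => intro a b F G h; exact h [] rfl List.Pairwise.nil (by simp)
  | succ r ih =>
    intro a b F G h
    unfold NS
    apply Finset.sum_congr rfl
    intro n hn
    rw [Finset.mem_Ioo] at hn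
    apply ih
    intro l hl hs hr
    apply h
    · simp [hl]
    · exact List.Pairwise.cons (fun m hm => (hr m hm).1) hs
    · intro m hm
      rcases List.mem_cons.1 hm with rfl | hm
      · exact hn
      · exact ⟨hn.1.trans (hr m hm).1, (hr m hm).2⟩

lemma NS_add {M : Type} [AddCommMonoid M] (r : ℕ) : ∀ (a b : ℤ) (F G : List ℤ → M),
    NS r a b (fun l => F l + G l) = NS r a b F + NS r a b G := by
  induction r with
  | zero => intro a b F G; rfl
  | succ r ih =>
    intro a b F G
    simp only [NS, ih, Finset.sum_add_distrib]

lemma NS_zero {M : Type} [AddCommMonoid M] (r : ℕ) : ∀ (a b : ℤ),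
    NS r a b (fun _ => (0 : M)) = 0 := by
  induction r with
  | zero => intro a b; rfl
  | succ r ih =>
    intro a b
    simp only [NS, ih, Finset.sum_const_zero]

lemma NS_sum {M ι : Type} [AddCommMonoid M] (s : Finset ι) (r : ℕ) (a b : ℤ) (F : ι → List ℤ → M) :
    NS r a b (fun l => ∑ i ∈ s, F i l) = ∑ i ∈ s, NS r a b (F i) := by
  classical
  induction s using Finset.induction_on with
  | empty => simp [NS_zero]
  | insert i s hi ih => simp only [Finset.sum_insert hi, NS_add, ih]

lemma NS_map {M M' : Type} [AddCommMonoid M] [AddCommMonoid M'] (φ : M →+ M') (r : ℕ) :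
    ∀ (a b : ℤ) (F : List ℤ → M), NS r a b (fun l => φ (F l)) = φ (NS r a b F) := by
  induction r with
  | zero => intro a b F; rfl
  | succ r ih =>
    intro a b F
    simp only [NS, ih, map_sum]

lemma NS_mul_left {R : Type} [CommRing R] (c : R) (r : ℕ) (a b : ℤ) (F : List ℤ → R) :
    NS r a b (fun l => c * F l) = c * NS r a b F :=
  NS_map (AddMonoidHom.mulLeft c) r a b F

lemma NS_mul_right {R : Type} [CommRing R] (c : R) (r : ℕ) (a b : ℤ) (F : List ℤ → R) :
    NS r a b (fun l => F l * c) = NS r a b F * c :=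
  NS_map (AddMonoidHom.mulRight c) r a b F

lemma NS_split {M : Type} [AddCommMonoid M] (j : ℕ) (b : ℤ) (i : ℕ) : ∀ (a : ℤ) (F : List ℤ → M),
    NS (i + 1 + j) a b F = ∑ v ∈ Finset.Ioo a b,
      NS i a v (fun l1 => NS j v b (fun l2 => F (l1 ++ v :: l2))) := by
  induction i with
  | zero =>
    intro a F
    rw [show 0 + 1 + j = j + 1 by ring]
    simp [NS]
  | succ i ih =>
    intro a F
    rw [show i + 1 + 1 + j = (i + 1 + j) + 1 by ring]
    simp only [NS]
    simp only [ih]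
    apply Finset.sum_comm'
    intro x y
    simp only [Finset.mem_Ioo]
    omega

/-- Nested sum of a product. -/
noncomputable def TS {R : Type} [CommRing R] (g : ℕ → ℤ → R) (r : ℕ) (a b : ℤ) : R :=
  NS r a b (fun l => ∏ p ∈ range r, g p (l.getD p 0))

lemma TS_zero {R : Type} [CommRing R] (g : ℕ → ℤ → R) (a b : ℤ) : TS g 0 a b = 1 := by
  simp [TS, NS]

lemma TS_succ {R : Type} [CommRing R] (g : ℕ → ℤ → R) (r : ℕ) (a b : ℤ) :
    TS g (r + 1) a b = ∑ n ∈ Finset.Ioo a b, g 0 n * TS (fun p => g (p + 1)) r n b := by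
  simp only [TS, NS, ← NS_mul_left]
  apply Finset.sum_congr rfl
  intro n _
  congr 1
  funext l
  rw [Finset.prod_range_succ']
  simp [mul_comm]

lemma TS_last {R : Type} [CommRing R] (g : ℕ → ℤ → R) (r : ℕ) (a b : ℤ) :
    TS g (r + 1) a b = ∑ n ∈ Finset.Ioo a b, g r n * TS g r a n := by
  have := NS_split 0 b r a (fun l => ∏ p ∈ range (r+1), g p (l.getD p 0))
  rw [show r + 1 + 0 = r + 1 by ring] at this
  unfold TS
  rw [this]
  apply Finset.sum_congr rfl
  intro n _
  rw [← NS_mul_left]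
  apply NS_congr
  intro l hl _ _
  simp only [NS]
  rw [Finset.prod_range_succ, mul_comm]
  congr 1
  · simp [List.getD, hl]
  · apply Finset.prod_congr rfl
    intro p hp
    rw [Finset.mem_range] at hp
    simp [List.getD, List.getElem?_append_left, hl, hp]

lemma sum_Ioo_shift {M : Type} [AddCommMonoid M] (f : ℤ → M) (a b v : ℤ) :
    ∑ n ∈ Finset.Ioo a b, f (n - v) = ∑ n ∈ Finset.Ioo (a - v) (b - v), f n := by
  apply Finset.sum_nbij' (fun n => n - v) (fun n => n + v)
  · intro n hn; simp only [Finset.mem_Ioo] at *; omega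
  · intro n hn; simp only [Finset.mem_Ioo] at *; omega
  · intro n hn; ring
  · intro n hn; ring
  · intro n hn; rfl

lemma TS_shift {R : Type} [CommRing R] (v b : ℤ) (r : ℕ) : ∀ (g : ℕ → ℤ → R) (a : ℤ),
    TS (fun p n => g p (n - v)) r a b = TS g r (a - v) (b - v) := by
  induction r with
  | zero => intro g a; simp [TS_zero]
  | succ r ih =>
    intro g a
    rw [TS_succ, TS_succ, ← sum_Ioo_shift]
    apply Finset.sum_congr rfl
    intro n _
    rw [ih (fun p => g (p + 1))]

lemma TS_zero_split {R : Type} [CommRing R] (b : ℤ) (hb : 0 < b) (r : ℕ) : ∀ (g : ℕ → ℤ → R)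
    (hg : ∀ p < r, g p 0 = 0) (a : ℤ) (ha : a < 0),
    TS g r a b = ∑ i ∈ range (r + 1), TS g i a 0 * TS (fun p => g (i + p)) (r - i) 0 b := by
  induction r with
  | zero => intro g _ a _; simp [TS_zero]
  | succ r ih =>
    intro g hg a ha
    rw [Finset.sum_range_succ', TS_succ]
    have h0 : Finset.Ioo a b = Finset.Ioo a 0 ∪ insert 0 (Finset.Ioo 0 b) := by
      ext n; simp only [Finset.mem_union, Finset.mem_insert, Finset.mem_Ioo]; omega
    have hd : Disjoint (Finset.Ioo a 0) (insert 0 (Finset.Ioo 0 b)) := by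
      rw [Finset.disjoint_left]
      intro n; simp only [Finset.mem_insert, Finset.mem_Ioo]; omega
    rw [h0, Finset.sum_union hd, Finset.sum_insert (by simp), hg 0 (by omega), zero_mul, zero_add]
    congr 1
    · rw [Finset.sum_congr rfl (fun n hn => by
        rw [ih (fun p => g (p + 1)) (fun p hp => hg (p + 1) (by omega)) n (by simp at hn; omega)])]
      simp only [Finset.mul_sum]
      rw [Finset.sum_comm]
      apply Finset.sum_congr rfl
      intro i _
      rw [TS_succ, Finset.sum_mul]
      apply Finset.sum_congr rfl
      intro n _
      rw [mul_assoc]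
      congr 3
      · funext p; congr 1; ring
      · omega
    · simp only [TS_zero, one_mul, Nat.sub_zero, zero_add]
      rw [TS_succ]

lemma NS_marked {R : Type} [CommRing R] (h : ℤ → R) (g : ℕ → ℤ → R) (i j : ℕ) (a b : ℤ) :
    NS (i + 1 + j) a b (fun l => h (l.getD i 0) *
      ∏ p ∈ (range (i + 1 + j)).erase i, g p (l.getD p 0 - l.getD i 0))
    = ∑ v ∈ Finset.Ioo a b, h v * (TS g i (a - v) 0 * TS (fun q => g (i + 1 + q)) j 0 (b - v)) := by
  rw [NS_split]
  apply Finset.sum_congr rfl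
  intro v _
  have e1 : TS g i (a - v) 0 = NS i a v (fun l => ∏ p ∈ range i, g p (l.getD p 0 - v)) := by
    have := TS_shift v v i g a
    rw [sub_self] at this
    rw [← this]; rfl
  have e2 : TS (fun q => g (i + 1 + q)) j 0 (b - v)
      = NS j v b (fun l => ∏ p ∈ range j, g (i + 1 + p) (l.getD p 0 - v)) := by
    have := TS_shift v b j (fun q => g (i + 1 + q)) v
    rw [sub_self] at this
    rw [← this]; rfl
  rw [e1, e2, ← NS_mul_right, ← NS_mul_left]
  apply NS_congr
  intro l1 hl1 _ _
  rw [← NS_mul_left, ← NS_mul_left]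
  apply NS_congr
  intro l2 hl2 _ _
  have gi : (l1 ++ v :: l2).getD i 0 = v := by simp [List.getD, hl1]
  rw [gi]
  congr 1
  have es : (range (i + 1 + j)).erase i = range i ∪ Finset.Ico (i+1) (i+1+j) := by
    ext n; simp only [Finset.mem_erase, Finset.mem_union, Finset.mem_range, Finset.mem_Ico]; omega
  have ed : Disjoint (range i) (Finset.Ico (i+1) (i+1+j)) := by
    rw [Finset.disjoint_left]
    intro n; simp only [Finset.mem_range, Finset.mem_Ico]; omega
  rw [es, Finset.prod_union ed, Finset.prod_Ico_eq_prod_range]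
  congr 1
  · apply Finset.prod_congr rfl
    intro p hp
    rw [Finset.mem_range] at hp
    simp [List.getD, List.getElem?_append_left, hl1, hp]
  · rw [show i + 1 + j - (i + 1) = j by omega]
    apply Finset.prod_congr rfl
    intro p hp
    have : (l1 ++ v :: l2).getD (i + 1 + p) 0 = l2.getD p 0 := by
      rw [List.getD_append_right _ _ _ _ (by omega), hl1, show i + 1 + p - i = p + 1 by omega]
      simp
    rw [this]

/-- The weight of one summation variable. -/
noncomputable def GW (κ : ℕ → ℕ) (ξ : ℕ → ℂ) (p : ℕ) (d : ℤ) : PowerSeries ℂ :=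
  PowerSeries.C (ξ p ^ d) * pinv (d : ℂ) ^ κ p

lemma master (r : ℕ) (hr : 0 < r) (κ : ℕ → ℕ) (hκ : ∀ i < r, 0 < κ i) (ξ : ℕ → ℂ)
    (hξ : ∀ i < r, ξ i ≠ 0) (a b : ℤ) (ha : a < 0) (hb : 0 < b) :
    PowerSeries.coeff 0 (∑ i ∈ range (r + 1), TS (GW κ ξ) i a 0 *
        TS (fun p => GW κ ξ (i + p)) (r - i) 0 b)
    + ∑ i ∈ range r, PowerSeries.coeff (κ i) (TS (GW κ ξ) i a 0 *
        TS (fun p => GW κ ξ (i + 1 + p)) (r - 1 - i) 0 b)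
    + ∑ i ∈ range r, PowerSeries.coeff (κ i - 1) (∑ v ∈ Finset.Ioo a b,
        (PowerSeries.C ((∏ p ∈ range r, ξ p) ^ v) * pinv (-(v : ℂ))) *
        (TS (GW κ ξ) i (a - v) 0 * TS (fun p => GW κ ξ (i + 1 + p)) (r - 1 - i) 0 (b - v))) = 0 := by
  have t1 : PowerSeries.coeff 0 (∑ i ∈ range (r + 1), TS (GW κ ξ) i a 0 *
        TS (fun p => GW κ ξ (i + p)) (r - i) 0 b) = NS r a b (fun l =>
          PowerSeries.coeff 0 (∏ p ∈ range r, GW κ ξ p (l.getD p 0))) := by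
    rw [← TS_zero_split b hb r (GW κ ξ) (fun p hp => by simp [GW, pinv_zero, (hκ p hp).ne']) a ha]
    exact (NS_map (PowerSeries.coeff (R := ℂ) 0).toAddMonoidHom r a b _).symm
  have t2 : ∀ i ∈ range r, PowerSeries.coeff (κ i) (TS (GW κ ξ) i a 0 *
        TS (fun p => GW κ ξ (i + 1 + p)) (r - 1 - i) 0 b) = NS r a b (fun l =>
          PowerSeries.coeff (κ i) ((if l.getD i 0 = 0 then 1 else 0) *
          ∏ p ∈ (range r).erase i, GW κ ξ p (l.getD p 0 - l.getD i 0))) := by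
    intro i hi
    rw [Finset.mem_range] at hi
    obtain ⟨j, rfl⟩ : ∃ j, r = i + 1 + j := ⟨r - (i + 1), by omega⟩
    have := NS_map (PowerSeries.coeff (R := ℂ) (κ i)).toAddMonoidHom (i + 1 + j) a b (fun l =>
      (if l.getD i 0 = 0 then 1 else 0) *
          ∏ p ∈ (range (i + 1 + j)).erase i, GW κ ξ p (l.getD p 0 - l.getD i 0))
    refine Eq.trans ?_ this.symm
    rw [NS_marked (fun n => if n = 0 then 1 else 0), Finset.sum_eq_single 0]
    · simp [show i + 1 + j - 1 - i = j by omega]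
    · intro v _ hv; simp [hv]
    · intro h; exact absurd (by simp [ha, hb]) h
  have t3 : ∀ i ∈ range r, PowerSeries.coeff (κ i - 1) (∑ v ∈ Finset.Ioo a b,
        (PowerSeries.C ((∏ p ∈ range r, ξ p) ^ v) * pinv (-(v : ℂ))) *
        (TS (GW κ ξ) i (a - v) 0 * TS (fun p => GW κ ξ (i + 1 + p)) (r - 1 - i) 0 (b - v)))
        = NS r a b (fun l =>
          PowerSeries.coeff (κ i - 1) ((PowerSeries.C ((∏ p ∈ range r, ξ p) ^ (l.getD i 0)) *
            pinv (-((l.getD i 0 : ℤ) : ℂ))) *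
          ∏ p ∈ (range r).erase i, GW κ ξ p (l.getD p 0 - l.getD i 0))) := by
    intro i hi
    rw [Finset.mem_range] at hi
    obtain ⟨j, rfl⟩ : ∃ j, r = i + 1 + j := ⟨r - (i + 1), by omega⟩
    have := NS_map (PowerSeries.coeff (R := ℂ) (κ i - 1)).toAddMonoidHom (i + 1 + j) a b (fun l =>
      (PowerSeries.C ((∏ p ∈ range (i + 1 + j), ξ p) ^ (l.getD i 0)) *
            pinv (-((l.getD i 0 : ℤ) : ℂ))) *
          ∏ p ∈ (range (i + 1 + j)).erase i, GW κ ξ p (l.getD p 0 - l.getD i 0))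
    refine Eq.trans ?_ this.symm
    rw [NS_marked (fun n => PowerSeries.C ((∏ p ∈ range (i + 1 + j), ξ p) ^ n) *
            pinv (-(n : ℂ)))]
    simp [show i + 1 + j - 1 - i = j by omega]
  rw [t1, Finset.sum_congr rfl t2, Finset.sum_congr rfl t3, ← NS_sum, ← NS_sum, ← NS_add, ← NS_add]
  refine Eq.trans ?_ (NS_zero r a b)
  apply NS_congr
  intro l hl hs hrange
  have hinj : Set.InjOn (fun p => ((l.getD p 0 : ℤ) : ℂ)) (range r : Finset ℕ) := by
    intro p hp q hq hpq
    simp only [Finset.coe_range, Set.mem_Iio] at hp hq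
    have h2 : l.getD p 0 = l.getD q 0 := Int.cast_injective (α := ℂ) hpq
    have hn : l.Nodup := hs.imp (fun h => ne_of_lt h)
    rw [List.getD_eq_getElem _ _ (by omega), List.getD_eq_getElem _ _ (by omega)] at h2
    exact (List.Nodup.getElem_inj_iff hn).1 h2
  have PF := pf_identity r hr _ hinj κ hκ
  have PF' := congrArg (fun z => (∏ p ∈ range r, ξ p ^ (l.getD p 0)) * z) PF
  simp only [mul_zero, mul_add, Finset.mul_sum] at PF'
  refine Eq.trans ?_ PF'
  have comm : ∀ (i : ℕ), ∏ p ∈ (range r).erase i, GW κ ξ p (l.getD p 0 - l.getD i 0)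
      = PowerSeries.C (∏ p ∈ (range r).erase i, ξ p ^ (l.getD p 0 - l.getD i 0)) *
        ∏ p ∈ (range r).erase i, pinv (((l.getD p 0 : ℤ) : ℂ) - ((l.getD i 0 : ℤ) : ℂ)) ^ κ p := by
    intro i
    simp only [GW, Finset.prod_mul_distrib, map_prod]
    push_cast
    rfl
  have comm2 : ∀ i ∈ range r, (∏ p ∈ range r, ξ p) ^ (l.getD i 0) *
      (∏ p ∈ (range r).erase i, ξ p ^ (l.getD p 0 - l.getD i 0)) = ∏ p ∈ range r, ξ p ^ (l.getD p 0) := by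
    intro i hi
    rw [← Finset.prod_zpow, ← Finset.mul_prod_erase _ _ hi, ← Finset.mul_prod_erase _ _ hi, mul_assoc,
      ← Finset.prod_mul_distrib]
    congr 1
    apply Finset.prod_congr rfl
    intro p hp
    rw [Finset.mem_erase, Finset.mem_range] at hp
    rw [← zpow_add₀ (hξ p hp.2)]
    congr 1; ring
  congr 1
  · congr 1
    · simp only [GW, Finset.prod_mul_distrib, ← map_prod, PowerSeries.coeff_C_mul]
    · apply Finset.sum_congr rfl
      intro i hi
      by_cases h0 : l.getD i 0 = 0
      · have := comm2 i hi
        rw [comm i]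
        simp only [h0, if_true, Int.cast_zero, zpow_zero, one_mul] at this ⊢
        rw [PowerSeries.coeff_C_mul, this]
      · have : ((l.getD i 0 : ℤ) : ℂ) ≠ 0 := by exact_mod_cast h0
        rw [if_neg h0, if_neg this]; simp
  · apply Finset.sum_congr rfl
    intro i hi
    rw [comm i, ← comm2 i hi, ← PowerSeries.coeff_C_mul, map_mul PowerSeries.C]
    congr 1
    ring

/-- Nested sums indexed by a list, outermost variable first. -/
noncomputable def QQ {α R : Type} [CommRing R] (w : α → ℕ → R) : List α → ℕ → R
  | [], _ => 1
  | p :: L, N => ∑ m ∈ range N, w p (m + 1) * QQ w L m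

noncomputable def wt (p : ℕ × ℂ) (m : ℕ) : ℂ := p.2 ^ m / (m : ℂ) ^ p.1

/-- fourth root of `m + 1` -/
noncomputable def er (m : ℕ) : ℝ := ((m : ℝ) + 1) ^ (1 / 4 : ℝ)

lemma er_pow (m : ℕ) : er m ^ 4 = (m : ℝ) + 1 := by
  unfold er
  rw [← Real.rpow_natCast, ← Real.rpow_mul (by positivity)]
  norm_num

lemma er_pos (m : ℕ) : 0 < er m := by unfold er; positivity

lemma er_mono {m n : ℕ} (h : m ≤ n) : er m ≤ er n := by
  unfold er
  have : (m : ℝ) ≤ n := by exact_mod_cast h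
  gcongr

lemma er_one (m : ℕ) : 1 ≤ er m := by
  have := er_mono (Nat.zero_le m)
  have h0 : er 0 = 1 := by simp [er]
  linarith

lemma er_tendsto : Tendsto er atTop atTop := by
  unfold er
  apply (tendsto_rpow_atTop (by norm_num : (0:ℝ) < 1/4)).comp
  exact tendsto_atTop_add_const_right _ _ tendsto_natCast_atTop_atTop

lemma er_succ (m : ℕ) : er (m + 1) ^ 4 = er m ^ 4 + 1 := by
  rw [er_pow, er_pow]; push_cast; ring

lemma er_inc3 (m : ℕ) : 1 / er m ^ 3 ≤ 8 * (er (m + 1) - er m) := by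
  have h := er_succ m
  have hb := er_one m
  have hab := er_mono (Nat.le_succ m)
  rw [Nat.succ_eq_add_one] at hab
  generalize er (m + 1) = a at *
  generalize er m = b at *
  have hb0 : 0 < b := by linarith
  have ha0 : 0 < a := by linarith
  have b4 : 1 ≤ b ^ 4 := one_le_pow₀ hb
  have h2 : a ^ 3 ≤ 2 * b ^ 3 := by
    have : a ^ 3 * b ≤ 2 * b ^ 3 * b := by
      calc a ^ 3 * b ≤ a ^ 3 * a := by gcongr
        _ = a ^ 4 := by ring
        _ ≤ 2 * b ^ 3 * b := by rw [h]; nlinarith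
    exact le_of_mul_le_mul_right this hb0
  have h3 : 1 ≤ (a - b) * (4 * a ^ 3) := by
    have e : (a - b) * (a ^ 3 + a ^ 2 * b + a * b ^ 2 + b ^ 3) = 1 := by linear_combination h
    rw [← e]
    have hd : 0 ≤ a - b := by linarith
    have i1 : a ^ 2 * b ≤ a ^ 3 := by rw [pow_succ a 2]; gcongr
    have i2 : a * b ^ 2 ≤ a ^ 3 := by
      calc a * b ^ 2 ≤ a * a ^ 2 := by gcongr
        _ = a ^ 3 := by ring
    have i3 : b ^ 3 ≤ a ^ 3 := by gcongr
    apply mul_le_mul_of_nonneg_left _ hd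
    linarith
  rw [div_le_iff₀ (by positivity)]
  have hd : 0 ≤ a - b := by linarith
  nlinarith [mul_le_mul_of_nonneg_left h2 hd]

lemma er_sum3 (N : ℕ) : ∑ m ∈ range N, 1 / er m ^ 3 ≤ 8 * er N := by
  induction N with
  | zero => simp; exact (er_pos 0).le
  | succ N ih =>
    rw [Finset.sum_range_succ]
    linarith [er_inc3 N]

lemma er_inc6 (m : ℕ) : 1 / er m ^ 6 ≤ 6 * (1 / er m ^ 2 - 1 / er (m + 1) ^ 2) := by
  have h := er_succ m
  have hb := er_one m
  have hab := er_mono (Nat.le_succ m)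
  rw [Nat.succ_eq_add_one] at hab
  generalize er (m + 1) = a at *
  generalize er m = b at *
  have hb0 : 0 < b := by linarith
  have ha0 : 0 < a := by linarith
  have hs : 1 ≤ b ^ 2 := one_le_pow₀ hb
  have hst : b ^ 2 ≤ a ^ 2 := by gcongr
  rw [show b ^ 6 = (b ^ 2) ^ 3 by ring]
  have h' : (a ^ 2) ^ 2 = (b ^ 2) ^ 2 + 1 := by linear_combination h
  generalize b ^ 2 = s at *
  generalize a ^ 2 = t at *
  have hs0 : 0 < s := by linarith
  have ht0 : 0 < t := by linarith
  have ht2 : t ≤ 2 * s := by nlinarith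
  have e : 1 / s - 1 / t = 1 / (s * t * (s + t)) := by
    field_simp
    linear_combination h'
  rw [e, ← mul_div_assoc, mul_one, div_le_div_iff₀ (by positivity) (by positivity)]
  have : s * t * (s + t) ≤ s * (2 * s) * (s + 2 * s) := by gcongr
  nlinarith

/-- convergence with rate -/
def Rate (u : ℕ → ℂ) (l : ℂ) : Prop := ∃ C : ℝ, ∀ M, ‖u M - l‖ ≤ C / er M ^ 2

lemma Rate.tendsto {u : ℕ → ℂ} {l : ℂ} (h : Rate u l) : Tendsto u atTop (nhds l) := by
  obtain ⟨C, hC⟩ := h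
  rw [tendsto_iff_norm_sub_tendsto_zero]
  have : Tendsto (fun M => C / er M ^ 2) atTop (nhds 0) :=
    Tendsto.const_div_atTop ((tendsto_pow_atTop (by norm_num)).comp er_tendsto) C
  exact squeeze_zero (fun _ => norm_nonneg _) hC this

lemma tele (u : ℕ → ℂ) (C : ℝ) (hC : 0 ≤ C) (h : ∀ m, ‖u (m + 1) - u m‖ ≤ C / er m ^ 6) :
    ∃ l, Rate u l := by
  have key : ∀ M d, ‖u (M + d) - u M‖ ≤ 6 * C * (1 / er M ^ 2 - 1 / er (M + d) ^ 2) := by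
    intro M d
    induction d with
    | zero => simp
    | succ d ih =>
      have h1 := h (M + d)
      have h2 := mul_le_mul_of_nonneg_left (er_inc6 (M + d)) hC
      have h3 : ‖u (M + (d + 1)) - u M‖ ≤ ‖u (M + d + 1) - u (M + d)‖ + ‖u (M + d) - u M‖ := by
        have : u (M + (d + 1)) - u M = (u (M + d + 1) - u (M + d)) + (u (M + d) - u M) := by
          rw [← add_assoc]; ring
        rw [this]; exact norm_add_le _ _
      rw [mul_one_div] at h2
      rw [show M + (d + 1) = M + d + 1 by ring] at *
      nlinarith
  have key2 : ∀ M d, ‖u (M + d) - u M‖ ≤ 6 * C / er M ^ 2 := by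
    intro M d
    refine (key M d).trans ?_
    rw [mul_sub, mul_one_div]
    have : 0 ≤ 6 * C * (1 / er (M + d) ^ 2) := by have := er_pos (M + d); positivity
    linarith
  have hz : Tendsto (fun M => 6 * C / er M ^ 2) atTop (nhds 0) :=
    Tendsto.const_div_atTop ((tendsto_pow_atTop (by norm_num)).comp er_tendsto) _
  have hcs : CauchySeq u := by
    apply cauchySeq_of_le_tendsto_0' (fun M => 6 * C / er M ^ 2) _ hz
    intro n m hnm
    obtain ⟨d, rfl⟩ := Nat.exists_eq_add_of_le hnm
    rw [dist_comm, dist_eq_norm]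
    exact key2 n d
  obtain ⟨l, hl⟩ := cauchySeq_tendsto_of_complete hcs
  refine ⟨l, 6 * C, fun M => ?_⟩
  rw [norm_sub_rev]
  have ht : Tendsto (fun d => ‖u (M + d) - u M‖) atTop (nhds ‖l - u M‖) := by
    have h1 : Tendsto (fun d => u (M + d)) atTop (nhds l) := by
      have := (tendsto_add_atTop_iff_nat M).2 hl
      simpa [add_comm] using this
    exact (h1.sub_const _).norm
  exact le_of_tendsto ht (Eventually.of_forall (key2 M))

def Valid (L : List (ℕ × ℂ)) : Prop := ∀ p ∈ L, 0 < p.1 ∧ ‖p.2‖ = 1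

lemma wt_norm (p : ℕ × ℂ) (hp : ‖p.2‖ = 1) (m : ℕ) :
    ‖wt p (m + 1)‖ = 1 / (er m ^ 4) ^ p.1 := by
  unfold wt
  rw [norm_div, norm_pow, hp, one_pow, norm_pow, er_pow, Complex.norm_natCast]
  push_cast; rfl

lemma wt_norm_le (p : ℕ × ℂ) (hp : ‖p.2‖ = 1) (k : ℕ) (hk : k ≤ p.1) (m : ℕ) :
    ‖wt p (m + 1)‖ ≤ 1 / (er m ^ 4) ^ k := by
  rw [wt_norm p hp]
  have h1 := er_one m
  have h4 : 1 ≤ er m ^ 4 := one_le_pow₀ h1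
  gcongr

lemma growth (L : List (ℕ × ℂ)) (hL : Valid L) : ∃ C : ℝ, 0 ≤ C ∧ ∀ N, ‖QQ wt L N‖ ≤ C * er N := by
  induction L with
  | nil => exact ⟨1, zero_le_one, fun N => by simpa [QQ] using er_one N⟩
  | cons p L ih =>
    obtain ⟨C, hC, h⟩ := ih (fun q hq => hL q (List.mem_cons_of_mem _ hq))
    have hp := hL p List.mem_cons_self
    refine ⟨8 * C, by positivity, fun N => ?_⟩
    unfold QQ
    calc _ ≤ ∑ m ∈ range N, ‖wt p (m + 1) * QQ wt L m‖ := norm_sum_le _ _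
      _ ≤ ∑ m ∈ range N, C * (1 / er m ^ 3) := by
        apply Finset.sum_le_sum
        intro m _
        rw [norm_mul]
        have h1 := wt_norm_le p hp.2 1 hp.1 m
        have := er_pos m
        calc _ ≤ 1 / (er m ^ 4) ^ 1 * (C * er m) := by gcongr; exact h m
          _ = _ := by field_simp
      _ = C * ∑ m ∈ range N, 1 / er m ^ 3 := by rw [Finset.mul_sum]
      _ ≤ C * (8 * er N) := by gcongr; exact er_sum3 N
      _ = _ := by ring

lemma incr (L : List (ℕ × ℂ)) (hL : Valid L) :
    ∃ C : ℝ, 0 ≤ C ∧ ∀ N, ‖QQ wt L (N + 1) - QQ wt L N‖ ≤ C / er N ^ 3 := by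
  cases L with
  | nil => exact ⟨0, le_rfl, fun N => by simp [QQ]⟩
  | cons p L =>
    obtain ⟨C, hC, h⟩ := growth L (fun q hq => hL q (List.mem_cons_of_mem _ hq))
    have hp := hL p List.mem_cons_self
    refine ⟨C, hC, fun m => ?_⟩
    unfold QQ
    rw [Finset.sum_range_succ, add_sub_cancel_left, norm_mul]
    have h1 := wt_norm_le p hp.2 1 hp.1 m
    have := er_pos m
    calc _ ≤ 1 / (er m ^ 4) ^ 1 * (C * er m) := by gcongr; exact h m
      _ = _ := by field_simp

lemma rate_exists (L : List (ℕ × ℂ)) (hL : Valid L) (hh : ∀ p ∈ L.head?, ¬(p.1 = 1 ∧ p.2 = 1)) :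
    ∃ l, Rate (QQ wt L) l := by
  cases L with
  | nil => exact ⟨1, 0, fun M => by simp [QQ]⟩
  | cons p L =>
    have hL' : Valid L := fun q hq => hL q (List.mem_cons_of_mem _ hq)
    have hp := hL p List.mem_cons_self
    have hh := hh p (by simp)
    obtain ⟨C, hC, h⟩ := growth L hL'
    obtain ⟨C', hC', h'⟩ := incr L hL'
    by_cases hk : 2 ≤ p.1
    · apply tele _ C hC
      intro m
      unfold QQ
      rw [Finset.sum_range_succ, add_sub_cancel_left, norm_mul]
      have h1 := wt_norm_le p hp.2 2 hk m
      have := er_one m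
      calc _ ≤ 1 / (er m ^ 4) ^ 2 * (C * er m) := by gcongr; exact h m
        _ = C / er m ^ 7 := by field_simp
        _ ≤ C / er m ^ 6 := by gcongr <;> norm_num
    · have hk1 : p.1 = 1 := by omega
      have hx1 : p.2 ≠ 1 := fun h => hh ⟨hk1, h⟩
      have hx0 : p.2 - 1 ≠ 0 := sub_ne_zero.2 hx1
      set x := p.2 with hx
      set E : ℕ → ℂ := fun m => x ^ (m + 1) / (x - 1) with hE
      set D : ℝ := 1 / ‖x - 1‖ with hD
      have hD0 : 0 ≤ D := by positivity
      have hEn : ∀ m, ‖E m‖ = D := by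
        intro m; simp [hE, hD, hp.2]
      set f : ℕ → ℂ := fun m => QQ wt L m / ((m : ℂ) + 1) with hf
      have hfn : ∀ m, ‖f m‖ ≤ C / er m ^ 3 := by
        intro m
        have := er_pos m
        simp only [hf, norm_div]
        rw [show ‖(m : ℂ) + 1‖ = er m ^ 4 by
          rw [er_pow]; have := Complex.norm_natCast (m + 1); push_cast at this; exact this]
        calc _ ≤ C * er m / er m ^ 4 := by gcongr; exact h m
          _ = _ := by field_simp
      have hv : ∃ l, Rate (fun M => QQ wt (p :: L) M - E M * f M) l := by
        apply tele _ (D * (C' + C)) (by positivity)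
        intro m
        have e1 : QQ wt (p :: L) (m + 1) = QQ wt (p :: L) m + x ^ (m + 1) * f m := by
          unfold QQ
          rw [Finset.sum_range_succ]
          congr 1
          simp only [wt, hf, hk1, pow_one, ← hx]
          push_cast; ring
        have e2 : E (m + 1) - E m = x ^ (m + 1) := by
          simp only [hE]; field_simp; ring
        have e3 : QQ wt (p :: L) (m + 1) - E (m + 1) * f (m + 1) - (QQ wt (p :: L) m - E m * f m)
            = E (m + 1) * (f m - f (m + 1)) := by
          rw [e1]; linear_combination (- f m) * e2
        rw [e3, norm_mul, hEn]
        have hm1 : ((m : ℂ) + 1) ≠ 0 := by exact_mod_cast Nat.succ_ne_zero m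
        have hm2 : ((m : ℂ) + 2) ≠ 0 := by exact_mod_cast Nat.succ_ne_zero (m + 1)
        have e4 : f m - f (m + 1) = f m * (1 / ((m : ℂ) + 2))
            - (QQ wt L (m + 1) - QQ wt L m) * (1 / ((m : ℂ) + 2)) := by
          simp only [hf]; push_cast
          rw [show (m : ℂ) + 1 + 1 = m + 2 by ring]
          field_simp; ring
        have e5 : ‖(1 / ((m : ℂ) + 2))‖ ≤ 1 / er m ^ 4 := by
          rw [norm_div, norm_one, er_pow]
          have := Complex.norm_natCast (m + 2); push_cast at this; rw [this]
          gcongr; norm_num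
        have hem := er_one m
        rw [mul_div_assoc]
        gcongr
        rw [e4]
        calc _ ≤ ‖f m * (1 / ((m : ℂ) + 2))‖ + ‖(QQ wt L (m + 1) - QQ wt L m) * (1 / ((m : ℂ) + 2))‖ :=
              norm_sub_le _ _
          _ ≤ (C / er m ^ 3) * (1 / er m ^ 4) + (C' / er m ^ 3) * (1 / er m ^ 4) := by
            rw [norm_mul, norm_mul]
            gcongr
            · exact hfn m
            · exact h' m
          _ = (C' + C) / er m ^ 7 := by field_simp; ring
          _ ≤ (C' + C) / er m ^ 6 := by gcongr <;> norm_num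
      obtain ⟨l, B, hB⟩ := hv
      refine ⟨l, B + D * C, fun M => ?_⟩
      have hem := er_one M
      have : QQ wt (p :: L) M - l = (QQ wt (p :: L) M - E M * f M - l) + E M * f M := by ring
      rw [this]
      refine (norm_add_le _ _).trans ?_
      rw [norm_mul, hEn, add_div]
      have h2 : D * ‖f M‖ ≤ D * C / er M ^ 2 := by
        rw [mul_div_assoc]
        gcongr
        refine (hfn M).trans ?_
        gcongr <;> norm_num
      linarith [hB M]

lemma Rate.bounded {u : ℕ → ℂ} {l : ℂ} (h : Rate u l) : ∃ B : ℝ, 0 ≤ B ∧ ∀ M, ‖u M‖ ≤ B := by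
  obtain ⟨C, hC⟩ := h
  refine ⟨|C| + ‖l‖, by positivity, fun M => ?_⟩
  have e : u M = (u M - l) + l := by ring
  rw [e]
  refine (norm_add_le _ _).trans ?_
  have := (hC M)
  have h1 : C / er M ^ 2 ≤ |C| := by
    have := er_one M
    have h2 : 1 ≤ er M ^ 2 := one_le_pow₀ this
    calc C / er M ^ 2 ≤ |C| / er M ^ 2 := by gcongr; exact le_abs_self C
      _ ≤ |C| / 1 := by gcongr
      _ = |C| := by simp
  linarith

lemma Rate.mul {u v : ℕ → ℂ} {l k : ℂ} (hu : Rate u l) (hv : Rate v k) : Rate (u * v) (l * k) := by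
  obtain ⟨B, hB, hB'⟩ := hv.bounded
  obtain ⟨C, hC⟩ := hu
  obtain ⟨D, hD⟩ := hv
  refine ⟨C * B + ‖l‖ * D, fun M => ?_⟩
  have e : (u * v) M - l * k = (u M - l) * v M + l * (v M - k) := by simp only [Pi.mul_apply]; ring
  rw [e]
  refine (norm_add_le _ _).trans ?_
  rw [norm_mul, norm_mul]
  have h1 : ‖u M - l‖ * ‖v M‖ ≤ C / er M ^ 2 * B :=
    mul_le_mul (hC M) (hB' M) (norm_nonneg _) ((norm_nonneg _).trans (hC M))
  have h2 : ‖l‖ * ‖v M - k‖ ≤ ‖l‖ * (D / er M ^ 2) := by gcongr; exact hD M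
  rw [add_div]
  calc _ ≤ _ := add_le_add h1 h2
    _ = _ := by ring

lemma Rate.add {u v : ℕ → ℂ} {l k : ℂ} (hu : Rate u l) (hv : Rate v k) : Rate (u + v) (l + k) := by
  obtain ⟨C, hC⟩ := hu
  obtain ⟨D, hD⟩ := hv
  refine ⟨C + D, fun M => ?_⟩
  have e : (u + v) M - (l + k) = (u M - l) + (v M - k) := by simp only [Pi.add_apply]; ring
  rw [e, add_div]
  exact (norm_add_le _ _).trans (add_le_add (hC M) (hD M))

lemma Rate.neg {u : ℕ → ℂ} {l : ℂ} (hu : Rate u l) : Rate (-u) (-l) := by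
  obtain ⟨C, hC⟩ := hu
  refine ⟨C, fun M => ?_⟩
  have e : (-u) M - (-l) = -(u M - l) := by simp only [Pi.neg_apply]; ring
  rw [e, norm_neg]; exact hC M

lemma Rate.const (l : ℂ) : Rate (fun _ => l) l := ⟨0, fun M => by simp⟩

lemma conv_lemma {α β : ℕ → ℂ} {lα lβ S : ℂ} (hα : Rate α lα) (hβ : Rate β lβ) (c : ℕ → ℂ)
    (hc : ∀ m, ‖c m‖ ≤ 1 / ((m : ℝ) + 1))
    (hS : Tendsto (fun N => ∑ m ∈ range N, c m) atTop (nhds S)) :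
    Tendsto (fun N => ∑ m ∈ range N, c m * (α (N + (m + 1)) * β (N - (m + 1)))) atTop
      (nhds (S * (lα * lβ))) := by
  obtain ⟨B, hB, hB'⟩ := hβ.bounded
  obtain ⟨C0, hC0⟩ := hα
  obtain ⟨D0, hD0⟩ := hβ
  set D := |C0| * B + ‖lα‖ * |D0| with hD
  have hDn : 0 ≤ D := by positivity
  have hbd : ∀ N, ∀ m ∈ range N, ‖α (N + (m + 1)) * β (N - (m + 1)) - lα * lβ‖ ≤ D / er (N - (m + 1)) ^ 2 := by
    intro N m hm
    have e : α (N + (m + 1)) * β (N - (m + 1)) - lα * lβ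
      = (α (N + (m + 1)) - lα) * β (N - (m + 1)) + lα * (β (N - (m + 1)) - lβ) := by ring
    rw [e]
    refine (norm_add_le _ _).trans ?_
    rw [norm_mul, norm_mul]
    have hpos := er_pos (N - (m + 1))
    have h1 : ‖α (N + (m + 1)) - lα‖ ≤ |C0| / er (N - (m + 1)) ^ 2 := by
      refine (hC0 _).trans ?_
      have : er (N - (m + 1)) ≤ er (N + (m + 1)) := er_mono (by omega)
      calc C0 / er (N + (m + 1)) ^ 2 ≤ |C0| / er (N + (m + 1)) ^ 2 := by
            have := er_pos (N + (m + 1)); gcongr; exact le_abs_self C0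
        _ ≤ _ := by gcongr
    have h2 : ‖β (N - (m + 1)) - lβ‖ ≤ |D0| / er (N - (m + 1)) ^ 2 := by
      refine (hD0 _).trans ?_
      gcongr; exact le_abs_self D0
    calc _ ≤ |C0| / er (N - (m + 1)) ^ 2 * B + ‖lα‖ * (|D0| / er (N - (m + 1)) ^ 2) := by
          gcongr; exact hB' _
      _ = _ := by rw [hD]; ring
  have hmain : Tendsto (fun N => (∑ m ∈ range N, c m) * (lα * lβ)) atTop (nhds (S * (lα * lβ))) :=
    hS.mul_const _
  have herr : Tendsto (fun N => ∑ m ∈ range N, c m * (α (N + (m + 1)) * β (N - (m + 1)) - lα * lβ))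
      atTop (nhds 0) := by
    have hz : Tendsto (fun N => 16 * D / er N) atTop (nhds 0) := Tendsto.const_div_atTop er_tendsto _
    apply squeeze_zero_norm _ hz
    intro N
    have hN := er_pos N
    calc _ ≤ ∑ m ∈ range N, ‖c m * (α (N + (m + 1)) * β (N - (m + 1)) - lα * lβ)‖ := norm_sum_le _ _
      _ ≤ ∑ m ∈ range N, D / er N ^ 2 * (1 / er m ^ 3 + 1 / er (N - 1 - m) ^ 3) := by
        apply Finset.sum_le_sum
        intro m hm
        rw [norm_mul]
        have h1 := hbd N m hm
        rw [show N - (m + 1) = N - 1 - m by omega] at h1 ⊢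
        have h2 := hc m
        rw [← er_pow] at h2
        rw [Finset.mem_range] at hm
        have e4 : er m ^ 4 + er (N - 1 - m) ^ 4 = er N ^ 4 := by
          rw [er_pow, er_pow, er_pow]
          have : ((N - 1 - m : ℕ) : ℝ) = N - 1 - m := by
            rw [Nat.cast_sub (by omega), Nat.cast_sub (by omega)]; simp
          rw [this]; ring
        have hq := er_one (N - 1 - m)
        have hn := er_one m
        have hqN : er (N - 1 - m) ≤ er N := er_mono (by omega)
        set q := er (N - 1 - m)
        set n := er m
        set T := er N
        have hq0 : 0 < q := by linarith
        have hn0 : 0 < n := by linarith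
        calc ‖c m‖ * ‖α (N + (m + 1)) * β (N - 1 - m) - lα * lβ‖ ≤ (1 / n ^ 4) * (D / q ^ 2) := by gcongr
          _ = D * (q ^ 2 / T ^ 4 * (1 / n ^ 4 + 1 / q ^ 4)) := by
            rw [← e4]; field_simp; ring
          _ ≤ D * (T ^ 2 / T ^ 4 * (1 / n ^ 3 + 1 / q ^ 3)) := by
            gcongr <;> norm_num
          _ = _ := by field_simp
      _ = D / er N ^ 2 * (∑ m ∈ range N, 1 / er m ^ 3 + ∑ m ∈ range N, 1 / er m ^ 3) := by
        rw [← Finset.mul_sum, Finset.sum_add_distrib,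
          Finset.sum_range_reflect (fun m => 1 / er m ^ 3) N]
      _ ≤ D / er N ^ 2 * (8 * er N + 8 * er N) := by
        gcongr <;> exact er_sum3 N
      _ = _ := by field_simp; ring
  have := hmain.add herr
  rw [add_zero] at this
  refine this.congr fun N => ?_
  rw [Finset.sum_mul, ← Finset.sum_add_distrib]
  apply Finset.sum_congr rfl
  intro m _
  ring

lemma sum_Ioo_neg {M : Type} [AddCommMonoid M] (f : ℤ → M) (N : ℕ) :
    ∑ n ∈ Ioo (-((N : ℤ) + 1)) 0, f n = ∑ m ∈ range N, f (-((m : ℤ) + 1)) := by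
  symm
  refine Finset.sum_bij (fun m _ => -((m : ℤ) + 1)) ?_ ?_ ?_ ?_
  · intro m hm
    rw [Finset.mem_range] at hm
    rw [Finset.mem_Ioo]
    omega
  · intro a _ b _ h
    omega
  · intro b hb
    rw [Finset.mem_Ioo] at hb
    refine ⟨(-b - 1).toNat, ?_, ?_⟩
    · rw [Finset.mem_range]; omega
    · omega
  · intro a _; rfl

lemma sum_Ioo_pos {M : Type} [AddCommMonoid M] (f : ℤ → M) (N : ℕ) :
    ∑ n ∈ Ioo 0 ((N : ℤ) + 1), f n = ∑ m ∈ range N, f ((m : ℤ) + 1) := by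
  symm
  refine Finset.sum_bij (fun m _ => ((m : ℤ) + 1)) ?_ ?_ ?_ ?_
  · intro m hm
    rw [Finset.mem_range] at hm
    rw [Finset.mem_Ioo]
    omega
  · intro a _ b _ h
    omega
  · intro b hb
    rw [Finset.mem_Ioo] at hb
    refine ⟨(b - 1).toNat, ?_, ?_⟩
    · rw [Finset.mem_range]; omega
    · omega
  · intro a _; rfl

lemma sum_Ioo_both {M : Type} [AddCommMonoid M] (f : ℤ → M) (N : ℕ) :
    ∑ n ∈ Ioo (-((N : ℤ) + 1)) ((N : ℤ) + 1), f n =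
      ∑ m ∈ range N, f (-((m : ℤ) + 1)) + (f 0 + ∑ m ∈ range N, f ((m : ℤ) + 1)) := by
  rw [← sum_Ioo_neg, ← sum_Ioo_pos]
  have h1 : Ioo (-((N : ℤ) + 1)) ((N : ℤ) + 1)
      = Ioo (-((N : ℤ) + 1)) 0 ∪ ({0} ∪ Ioo 0 ((N : ℤ) + 1)) := by
    ext v
    simp only [Finset.mem_union, Finset.mem_Ioo, Finset.mem_singleton]
    omega
  rw [h1, Finset.sum_union, Finset.sum_union, Finset.sum_singleton]
  · rw [Finset.disjoint_left]
    intro v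
    simp only [Finset.mem_union, Finset.mem_Ioo, Finset.mem_singleton]
    omega
  · rw [Finset.disjoint_left]
    intro v
    simp only [Finset.mem_union, Finset.mem_Ioo, Finset.mem_singleton]
    omega

/-- power series weight attached to a pair `(k, x)` and a sign. -/
noncomputable def WP (ε : ℂ) (p : ℕ × ℂ) (m : ℕ) : PowerSeries ℂ :=
  PowerSeries.C (p.2 ^ m) * pinv (ε * (m : ℂ)) ^ p.1

lemma TS_neg (κ : ℕ → ℕ) (ξ : ℕ → ℂ) (i : ℕ) : ∀ (o N : ℕ),
    TS (fun p => GW κ ξ (o + p)) i (-((N : ℤ) + 1)) 0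
      = QQ (WP (-1)) ((List.range' o i).map (fun p => (κ p, (ξ p)⁻¹))) N := by
  induction i with
  | zero => intro o N; rw [TS_zero]; simp [QQ]
  | succ i ih =>
    intro o N
    rw [TS_succ, List.range'_succ, List.map_cons, QQ, sum_Ioo_neg]
    refine Finset.sum_congr rfl fun m _ => ?_
    congr 1
    · unfold GW WP
      congr 2
      · simp only [add_zero]
        rw [zpow_neg, inv_pow]
        norm_cast
      · push_cast
        congr 1
        ring
    · rw [← ih]
      congr 1
      funext p
      rw [show o + (p + 1) = o + 1 + p by ring]

lemma TS_pos (κ : ℕ → ℕ) (ξ : ℕ → ℂ) (o : ℕ) (j : ℕ) : ∀ (N : ℕ),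
    TS (fun p => GW κ ξ (o + p)) j 0 ((N : ℤ) + 1)
      = QQ (WP 1) ((List.range' o j).map (fun p => (κ p, ξ p))).reverse N := by
  induction j with
  | zero => intro N; rw [TS_zero]; simp [QQ]
  | succ i ih =>
    intro N
    rw [TS_last, List.range'_concat, List.map_append, List.reverse_append, sum_Ioo_pos]
    simp only [List.map_cons, List.map_nil, List.reverse_singleton, List.singleton_append, QQ]
    refine Finset.sum_congr rfl fun m _ => ?_
    congr 1
    · unfold GW WP
      congr 2
      · simp only [one_mul]
        norm_cast
      · push_cast
        simp
      · simp
    · rw [← ih]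

lemma coeff_pinv (c : ℂ) (hc : c ≠ 0) (a : ℕ) :
    PowerSeries.coeff a (pinv c) = (-1) ^ a * (c⁻¹) ^ (a + 1) := by
  have h := pinv_mul c hc
  induction a with
  | zero =>
    have h0 := congrArg (PowerSeries.coeff 0) h
    simp [add_mul, PowerSeries.coeff_C_mul] at h0
    have : PowerSeries.constantCoeff (pinv c) = c⁻¹ := by
      field_simp
      rw [mul_comm]; exact h0
    simpa using this
  | succ a ih =>
    have h0 := congrArg (PowerSeries.coeff (a + 1)) h
    rw [add_mul, map_add, PowerSeries.coeff_C_mul, PowerSeries.coeff_succ_X_mul, ih] at h0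
    rw [PowerSeries.coeff_one, if_neg (by omega)] at h0
    have : PowerSeries.coeff (a + 1) (pinv c) = - (c⁻¹ * ((-1) ^ a * (c⁻¹) ^ (a + 1))) := by
      have h2 : c * PowerSeries.coeff (a + 1) (pinv c) = - ((-1) ^ a * (c⁻¹) ^ (a + 1)) := by
        linear_combination h0
      rw [← mul_right_inj' hc, h2]
      field_simp
    rw [this]; ring

lemma coeff_pinv_pow (k : ℕ) : ∀ (a : ℕ), ∃ z : ℤ, ∀ c : ℂ, c ≠ 0 →
    PowerSeries.coeff a (pinv c ^ k) = z * (c⁻¹) ^ (k + a) := by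
  induction k with
  | zero =>
    intro a
    refine ⟨if a = 0 then 1 else 0, fun c hc => ?_⟩
    rw [pow_zero, PowerSeries.coeff_one]
    split_ifs with h
    · simp [h]
    · simp
  | succ k ih =>
    intro a
    choose z hz using ih
    refine ⟨∑ p ∈ antidiagonal a, z p.1 * (-1) ^ p.2, fun c hc => ?_⟩
    rw [pow_succ, PowerSeries.coeff_mul]
    push_cast
    rw [Finset.sum_mul]
    refine Finset.sum_congr rfl fun p hp => ?_
    rw [hz _ c hc, coeff_pinv c hc]
    have := Finset.HasAntidiagonal.mem_antidiagonal.1 hp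
    rw [← this]
    ring

/-- Lists obtained by raising exponents. -/
def Raise (L L' : List (ℕ × ℂ)) : Prop := List.Forall₂ (fun p q => p.1 ≤ q.1 ∧ q.2 = p.2) L L'

lemma coeff_QQ (ε : ℂ) (hε : ε = 1 ∨ ε = -1) (L : List (ℕ × ℂ)) : ∀ a : ℕ,
    (fun N => PowerSeries.coeff a (QQ (WP ε) L N)) ∈
      AddSubgroup.closure {u : ℕ → ℂ | ∃ L', Raise L L' ∧ u = QQ wt L'} := by
  induction L with
  | nil =>
    intro a
    by_cases ha : a = 0
    · subst ha
      apply AddSubgroup.subset_closure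
      refine ⟨[], List.Forall₂.nil, ?_⟩
      funext N
      simp [QQ]
    · have : (fun N => PowerSeries.coeff a (QQ (WP ε) [] N)) = 0 := by
        funext N
        simp [QQ, PowerSeries.coeff_one, ha]
      rw [this]
      exact zero_mem _
  | cons p L ih =>
    intro a
    have key : ∀ (b : ℕ) (u : ℕ → ℂ),
        u ∈ AddSubgroup.closure {u : ℕ → ℂ | ∃ L', Raise L L' ∧ u = QQ wt L'} →
        (fun N => ∑ m ∈ range N, PowerSeries.coeff b (WP ε p (m + 1)) * u m) ∈
          AddSubgroup.closure {u : ℕ → ℂ | ∃ L', Raise (p :: L) L' ∧ u = QQ wt L'} := by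
      intro b u hu
      induction hu using AddSubgroup.closure_induction with
      | mem u hu =>
        obtain ⟨L', hL', rfl⟩ := hu
        obtain ⟨z, hz⟩ := coeff_pinv_pow p.1 b
        have hgen : QQ wt ((p.1 + b, p.2) :: L') ∈
            AddSubgroup.closure {u : ℕ → ℂ | ∃ L', Raise (p :: L) L' ∧ u = QQ wt L'} := by
          apply AddSubgroup.subset_closure
          exact ⟨(p.1 + b, p.2) :: L', List.Forall₂.cons ⟨Nat.le_add_right _ _, rfl⟩ hL', rfl⟩
        obtain ⟨e, he⟩ : ∃ e : ℤ, (e : ℂ) = ε ^ (p.1 + b) := by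
          rcases hε with rfl | rfl
          · exact ⟨1, by simp⟩
          · exact ⟨(-1) ^ (p.1 + b), by push_cast; rfl⟩
        have := AddSubgroup.zsmul_mem _ hgen (z * e)
        convert this using 1
        funext N
        simp only [Pi.smul_apply, QQ, zsmul_eq_mul]
        rw [Finset.mul_sum]
        refine Finset.sum_congr rfl fun m _ => ?_
        unfold WP wt
        have hm : ((m + 1 : ℕ) : ℂ) ≠ 0 := by exact_mod_cast Nat.succ_ne_zero m
        have hε0 : ε ≠ 0 := by rcases hε with rfl | rfl <;> norm_num
        have hinv : ε⁻¹ = ε := by rcases hε with rfl | rfl <;> norm_num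
        rw [PowerSeries.coeff_C_mul, hz _ (mul_ne_zero hε0 hm)]
        push_cast
        rw [he, mul_inv, hinv, mul_pow]
        simp only [div_eq_mul_inv, inv_pow]
        ring
      | zero =>
        simp only [Pi.zero_apply, mul_zero, Finset.sum_const_zero]
        exact zero_mem _
      | add u v _ _ hu hv =>
        convert add_mem hu hv using 1
        funext N
        simp only [Pi.add_apply, mul_add, Finset.sum_add_distrib]
      | neg u _ hu =>
        convert neg_mem hu using 1
        funext N
        simp only [Pi.neg_apply, mul_neg, Finset.sum_neg_distrib]
    have : (fun N => PowerSeries.coeff a (QQ (WP ε) (p :: L) N)) =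
        ∑ q ∈ antidiagonal a, (fun N => ∑ m ∈ range N, PowerSeries.coeff q.1 (WP ε p (m + 1)) *
          PowerSeries.coeff q.2 (QQ (WP ε) L m)) := by
      funext N
      rw [Finset.sum_apply, Finset.sum_comm]
      simp only [QQ, map_sum, PowerSeries.coeff_mul]
    rw [this]
    exact sum_mem fun q _ => key q.1 _ (ih q.2)

lemma coeff_zero_QQ (ε : ℂ) (hε : ε = 1 ∨ ε = -1) (L : List (ℕ × ℂ)) : ∀ N : ℕ,
    PowerSeries.coeff 0 (QQ (WP ε) L N) = ε ^ (L.map Prod.fst).sum * QQ wt L N := by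
  induction L with
  | nil => intro N; simp [QQ]
  | cons p L ih =>
    intro N
    simp only [QQ, map_sum, List.map_cons, List.sum_cons]
    rw [Finset.mul_sum]
    refine Finset.sum_congr rfl fun m _ => ?_
    have hmul : ∀ f g : PowerSeries ℂ, PowerSeries.coeff 0 (f * g)
        = PowerSeries.coeff 0 f * PowerSeries.coeff 0 g := by
      intro f g
      simp only [PowerSeries.coeff_zero_eq_constantCoeff_apply, map_mul]
    rw [hmul, ih]
    have hm : ((m + 1 : ℕ) : ℂ) ≠ 0 := by exact_mod_cast Nat.succ_ne_zero m
    have hε0 : ε ≠ 0 := by rcases hε with rfl | rfl <;> norm_num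
    have hinv : ε⁻¹ = ε := by rcases hε with rfl | rfl <;> norm_num
    have h0 : PowerSeries.coeff 0 (WP ε p (m + 1)) = ε ^ p.1 * wt p (m + 1) := by
      have h1 := coeff_pinv (ε * ((m + 1 : ℕ) : ℂ)) (mul_ne_zero hε0 hm) 0
      rw [PowerSeries.coeff_zero_eq_constantCoeff_apply] at h1 ⊢
      unfold WP wt
      rw [map_mul, PowerSeries.constantCoeff_C, map_pow, h1, pow_zero, one_mul, zero_add, pow_one,
        mul_inv, hinv, mul_pow, inv_pow]
      ring
    rw [h0]
    ring

/-- strictly increasing natural number tuples below `N`. -/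
noncomputable def IT (p N : ℕ) : Finset (Fin p → ℕ) := by
  classical
  exact (Fintype.piFinset fun _ : Fin p => range N).filter StrictMono

lemma mem_IT (p N : ℕ) (n : Fin p → ℕ) : n ∈ IT p N ↔ (∀ j, n j < N) ∧ StrictMono n := by
  classical
  unfold IT
  rw [Finset.mem_filter, Fintype.mem_piFinset]
  simp

lemma IT_succ (p N : ℕ) (F : (Fin (p + 1) → ℕ) → ℂ) :
    ∑ n ∈ IT (p + 1) N, F n = ∑ m ∈ range N, ∑ n ∈ IT p m, F (Fin.snoc n m) := by
  rw [Finset.sum_sigma']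
  refine Finset.sum_bij' (fun n _ => ⟨n (Fin.last p), Fin.init n⟩) (fun q _ => Fin.snoc q.2 q.1)
    ?_ ?_ ?_ ?_ ?_
  · intro n hn
    rw [mem_IT] at hn
    rw [Finset.mem_sigma]
    refine ⟨Finset.mem_range.2 (hn.1 _), ?_⟩
    rw [mem_IT]
    exact ⟨fun j => hn.2 (Fin.castSucc_lt_last j),
      fun a b hab => hn.2 (Fin.castSucc_lt_castSucc_iff.2 hab)⟩
  · intro q hq
    rw [Finset.mem_sigma, Finset.mem_range, mem_IT] at hq
    obtain ⟨h1, h2, h3⟩ := hq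
    rw [mem_IT]
    refine ⟨fun j => ?_, fun a b hab => ?_⟩
    · induction j using Fin.lastCases with
      | last => simpa using h1
      | cast j => simpa using (h2 j).trans h1
    · induction b using Fin.lastCases with
      | last =>
        induction a using Fin.lastCases with
        | last => exact absurd hab (lt_irrefl _)
        | cast a => simpa using h2 a
      | cast b =>
        induction a using Fin.lastCases with
        | last => exact absurd hab (not_lt.2 (Fin.le_last _))
        | cast a => simpa using h3 (Fin.castSucc_lt_castSucc_iff.1 hab)
  · intro n hn
    exact Fin.snoc_init_self n
  · intro q hq
    simp
  · intro n hn
    rw [Fin.snoc_init_self]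

lemma IT_QQ {α : Type} (w : α → ℕ → ℂ) (p : ℕ) : ∀ (e : Fin p → α) (N : ℕ),
    ∑ n ∈ IT p N, ∏ j, w (e j) (n j + 1) = QQ w (List.ofFn e).reverse N := by
  induction p with
  | zero =>
    intro e N
    have : IT 0 N = {Fin.elim0} := by
      ext n
      rw [mem_IT, Finset.mem_singleton]
      constructor
      · intro _; exact Subsingleton.elim _ _
      · intro _; exact ⟨fun j => j.elim0, fun j => j.elim0⟩
    rw [this]
    simp [QQ]
  | succ p ih =>
    intro e N
    rw [IT_succ, List.ofFn_succ', List.concat_eq_append, List.reverse_append]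
    simp only [List.reverse_singleton, List.singleton_append, QQ]
    refine Finset.sum_congr rfl fun m _ => ?_
    rw [← ih, Finset.mul_sum]
    refine Finset.sum_congr rfl fun n _ => ?_
    rw [Fin.prod_univ_castSucc]
    simp only [Fin.snoc_castSucc, Fin.snoc_last]
    ring

lemma QQ_map {α β : Type} (f : α → β) (w : β → ℕ → ℂ) (L : List α) : ∀ N,
    QQ w (L.map f) N = QQ (fun p => w (f p)) L N := by
  induction L with
  | nil => intro N; simp [QQ]
  | cons p L ih => intro N; simp [QQ, ih]

lemma cmhzP_eq (K : List (ℕ × ℂ × ℂ)) (N : ℕ) :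
    cmhzP K N = QQ (fun (p : ℕ × ℂ × ℂ) (m : ℕ) => p.2.1 ^ m / ((m : ℂ) + p.2.2 - 1) ^ p.1)
      K.reverse N := by
  have h := IT_QQ (fun (p : ℕ × ℂ × ℂ) (m : ℕ) => p.2.1 ^ m / ((m : ℂ) + p.2.2 - 1) ^ p.1)
    K.length K.get N
  rw [List.ofFn_get] at h
  rw [← h]
  unfold cmhzP
  refine Finset.sum_bij (fun n _ => fun j => (n j : ℕ)) ?_ ?_ ?_ ?_
  · intro n hn
    rw [Finset.mem_filter] at hn
    rw [mem_IT]
    exact ⟨fun j => (n j).2, fun a b hab => hn.2 hab⟩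
  · intro a _ b _ hab
    funext j
    exact Fin.ext (congrFun hab j)
  · intro b hb
    rw [mem_IT] at hb
    refine ⟨fun j => ⟨b j, hb.1 j⟩, ?_, rfl⟩
    rw [Finset.mem_filter]
    exact ⟨Finset.mem_univ _, fun a c hac => hb.2 hac⟩
  · intro n _
    rfl

lemma cmhzP_wt (K : List (ℕ × ℂ)) :
    cmhzP (K.map fun p => (p.1, p.2, 1)) = QQ wt K.reverse := by
  funext N
  rw [cmhzP_eq, ← List.map_reverse, QQ_map]
  congr 1
  funext p m
  simp [wt]

lemma cmzv_eq (K : List (ℕ × ℂ)) (l : ℂ) (h : Rate (QQ wt K.reverse) l) : cmzv K = l := by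
  unfold cmzv cmhz
  rw [cmhzP_wt]
  exact h.tendsto.limUnder_eq

lemma root_norm {z : ℂ} (h : IsRootOfUnity z) : ‖z‖ = 1 := by
  obtain ⟨N, hN, h⟩ := h
  exact Complex.norm_eq_one_of_pow_eq_one h hN.ne'

lemma root_inv {z : ℂ} (h : IsRootOfUnity z) : IsRootOfUnity z⁻¹ := by
  obtain ⟨N, hN, h⟩ := h
  exact ⟨N, hN, by rw [inv_pow, h, inv_one]⟩

lemma root_mul {z w : ℂ} (h : IsRootOfUnity z) (h' : IsRootOfUnity w) : IsRootOfUnity (z * w) := by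
  obtain ⟨N, hN, h⟩ := h
  obtain ⟨M, hM, h'⟩ := h'
  exact ⟨N * M, Nat.mul_pos hN hM, by rw [mul_pow, pow_mul, h, mul_comm N, pow_mul w, h']; simp⟩

lemma root_prod (r : ℕ) (ξ : ℕ → ℂ) (h : ∀ i < r, IsRootOfUnity (ξ i)) :
    IsRootOfUnity (∏ i ∈ range r, ξ i) := by
  induction r with
  | zero => exact ⟨1, one_pos, by simp⟩
  | succ r ih =>
    rw [Finset.prod_range_succ]
    exact root_mul (ih fun i hi => h i (by omega)) (h r (by omega))

/-- lists of positive integers and roots of unity whose first entry is admissible. -/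
def Adm (L : List (ℕ × ℂ)) : Prop :=
  (∀ p ∈ L, 0 < p.1 ∧ IsRootOfUnity p.2) ∧ ∀ p ∈ L.head?, ¬(p.1 = 1 ∧ p.2 = 1)

lemma Adm.rate {L : List (ℕ × ℂ)} (h : Adm L) : Rate (QQ wt L) (cmzv L.reverse) := by
  obtain ⟨l, hl⟩ := rate_exists L (fun p hp => ⟨(h.1 p hp).1, root_norm (h.1 p hp).2⟩) h.2
  have := cmzv_eq L.reverse l (by rwa [List.reverse_reverse])
  rwa [this]

lemma Adm.raise {L L' : List (ℕ × ℂ)} (h : Adm L) (hr : Raise L L') : Adm L' := by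
  unfold Raise at hr
  constructor
  · have h1 := h.1
    clear h
    induction hr with
    | nil => simp
    | cons hab _ ih =>
      intro p hp
      rcases List.mem_cons.1 hp with rfl | hp
      · have := h1 _ List.mem_cons_self
        exact ⟨lt_of_lt_of_le this.1 hab.1, by rw [hab.2]; exact this.2⟩
      · exact ih (fun p hp => h1 p (List.mem_cons_of_mem _ hp)) p hp
  · cases hr with
    | nil => simp
    | cons hab _ =>
      rename_i a b l1 l2 _
      intro p hp
      simp only [List.head?_cons, Option.mem_def, Option.some.injEq] at hp
      subst hp
      intro hc
      have h3 := h.1 a List.mem_cons_self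
      apply h.2 a (by simp)
      exact ⟨by have := hab.1; omega, by rw [← hab.2]; exact hc.2⟩

/-- the ring in the statement. -/
noncomputable def AA (d : ℕ) : Subring ℂ := Subring.closure
        ((Subfield.closure {z : ℂ | IsRootOfUnity z} : Set ℂ)
          ∪ {z : ℂ | ∃ K : List (ℕ × ℂ), K.length ≤ d ∧
              (∀ p ∈ K, 0 < p.1 ∧ IsRootOfUnity p.2) ∧
              (∀ p ∈ K.getLast?, ¬(p.1 = 1 ∧ p.2 = 1)) ∧ z = cmzv K})

lemma Adm.mem {L : List (ℕ × ℂ)} (h : Adm L) {d : ℕ} (hd : L.length ≤ d) : cmzv L.reverse ∈ AA d := by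
  apply Subring.subset_closure
  right
  refine ⟨L.reverse, by simpa using hd, ?_, ?_, rfl⟩
  · intro p hp
    exact h.1 p (List.mem_reverse.1 hp)
  · rw [List.getLast?_reverse]
    exact h.2

/-- sequences converging at a rate to an element of the ring. -/
def Good (d : ℕ) (u : ℕ → ℂ) : Prop := ∃ l ∈ AA d, Rate u l

lemma Good.add {d : ℕ} {u v : ℕ → ℂ} (hu : Good d u) (hv : Good d v) : Good d (u + v) := by
  obtain ⟨l, hl, h⟩ := hu
  obtain ⟨m, hm, h'⟩ := hv
  exact ⟨_, add_mem hl hm, h.add h'⟩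

lemma Good.neg {d : ℕ} {u : ℕ → ℂ} (hu : Good d u) : Good d (-u) := by
  obtain ⟨l, hl, h⟩ := hu
  exact ⟨_, neg_mem hl, h.neg⟩

lemma Good.zero {d : ℕ} : Good d 0 := ⟨0, zero_mem _, Rate.const 0⟩

lemma Good.mul {d : ℕ} {u v : ℕ → ℂ} (hu : Good d u) (hv : Good d v) : Good d (u * v) := by
  obtain ⟨l, hl, h⟩ := hu
  obtain ⟨m, hm, h'⟩ := hv
  exact ⟨_, mul_mem hl hm, h.mul h'⟩

lemma Good.sum {d : ℕ} {ι : Type} (s : Finset ι) (u : ι → ℕ → ℂ) (h : ∀ i ∈ s, Good d (u i)) :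
    Good d (∑ i ∈ s, u i) :=
  Finset.sum_induction u (Good d) (fun _ _ => Good.add) Good.zero h

lemma good_coeff (d : ℕ) (ε : ℂ) (hε : ε = 1 ∨ ε = -1) (L : List (ℕ × ℂ)) (hL : Adm L)
    (hd : L.length ≤ d) (a : ℕ) : Good d (fun N => PowerSeries.coeff a (QQ (WP ε) L N)) := by
  have h := coeff_QQ ε hε L a
  generalize (fun N => PowerSeries.coeff a (QQ (WP ε) L N)) = u at h
  induction h using AddSubgroup.closure_induction with
  | mem u hu =>
    obtain ⟨L', hL', rfl⟩ := hu
    have hlen : L.length = L'.length := List.Forall₂.length_eq hL'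
    exact ⟨_, (hL.raise hL').mem (by omega), (hL.raise hL').rate⟩
  | zero => exact Good.zero
  | add u v _ _ hu hv => exact hu.add hv
  | neg u _ hu => exact hu.neg

lemma good_coeff_mul (d : ℕ) (f g : ℕ → PowerSeries ℂ)
    (hf : ∀ a, Good d (fun N => PowerSeries.coeff a (f N)))
    (hg : ∀ a, Good d (fun N => PowerSeries.coeff a (g N))) (a : ℕ) :
    Good d (fun N => PowerSeries.coeff a (f N * g N)) := by
  have : (fun N => PowerSeries.coeff a (f N * g N)) = ∑ q ∈ antidiagonal a,
      (fun N => PowerSeries.coeff q.1 (f N)) * (fun N => PowerSeries.coeff q.2 (g N)) := by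
    funext N
    rw [PowerSeries.coeff_mul, Finset.sum_apply]
    rfl
  rw [this]
  exact Good.sum _ _ fun q _ => (hf _).mul (hg _)

/-- sequences converging to an element of the ring. -/
def Cvg (d : ℕ) (u : ℕ → ℂ) : Prop := ∃ l ∈ AA d, Tendsto u atTop (nhds l)

lemma Good.cvg {d : ℕ} {u : ℕ → ℂ} (h : Good d u) : Cvg d u := by
  obtain ⟨l, hl, h⟩ := h
  exact ⟨l, hl, h.tendsto⟩

lemma Cvg.add {d : ℕ} {u v : ℕ → ℂ} (hu : Cvg d u) (hv : Cvg d v) : Cvg d (u + v) := by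
  obtain ⟨l, hl, h⟩ := hu
  obtain ⟨m, hm, h'⟩ := hv
  exact ⟨_, add_mem hl hm, h.add h'⟩

lemma Cvg.zero {d : ℕ} : Cvg d 0 := ⟨0, zero_mem _, tendsto_const_nhds⟩

lemma Cvg.sum {d : ℕ} {ι : Type} (s : Finset ι) (u : ι → ℕ → ℂ) (h : ∀ i ∈ s, Cvg d (u i)) :
    Cvg d (∑ i ∈ s, u i) :=
  Finset.sum_induction u (Cvg d) (fun _ _ => Cvg.add) Cvg.zero h

lemma conv_term (d : ℕ) (hd : 1 ≤ d) (Y : ℂ) (hY : IsRootOfUnity Y) (hY1 : Y ≠ 1) (b : ℕ) (σ : ℤ)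
    (hσ : ‖(σ : ℂ)‖ = 1) (u v : ℕ → ℂ) (hu : Good d u) (hv : Good d v) :
    Cvg d (fun N => ∑ m ∈ range N, ((σ : ℂ) * wt (b + 1, Y) (m + 1)) *
      (u (N + (m + 1)) * v (N - (m + 1)))) := by
  obtain ⟨l, hl, hu⟩ := hu
  obtain ⟨l', hl', hv⟩ := hv
  have hA : Adm [(b + 1, Y)] := by
    constructor
    · intro p hp
      rw [List.mem_singleton] at hp
      subst hp
      exact ⟨Nat.succ_pos _, hY⟩
    · intro p hp
      simp only [List.head?_cons, Option.mem_def, Option.some.injEq] at hp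
      subst hp
      exact fun h => hY1 h.2
  have hmem := hA.mem (d := d) (by simpa using hd)
  have hrate := hA.rate
  refine ⟨_, ?_, conv_lemma hu hv _ ?_ (S := σ * cmzv [(b + 1, Y)].reverse) ?_⟩
  · exact mul_mem (mul_mem (intCast_mem _ _) hmem) (mul_mem hl hl')
  · intro m
    rw [norm_mul, hσ, one_mul]
    have := wt_norm_le (b + 1, Y) (root_norm hY) 1 (by simp) m
    rw [er_pow] at this
    simpa using this
  · have h2 := hrate.tendsto.const_mul (σ : ℂ)
    refine h2.congr fun N => ?_
    simp [QQ, Finset.mul_sum]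

lemma coeff_YP (Y ε : ℂ) (e : ℤ) (he : (e : ℂ) = ε) (hinv : ε⁻¹ = ε) (hε0 : ε ≠ 0) (b m : ℕ) :
    PowerSeries.coeff b (PowerSeries.C (Y ^ (m + 1)) *
      pinv (ε * ((m + 1 : ℕ) : ℂ))) = (((-1) ^ b * e ^ (b + 1) : ℤ) : ℂ) * wt (b + 1, Y) (m + 1) := by
  have hm : ((m + 1 : ℕ) : ℂ) ≠ 0 := by exact_mod_cast Nat.succ_ne_zero m
  rw [PowerSeries.coeff_C_mul, coeff_pinv _ (mul_ne_zero hε0 hm), mul_inv, hinv, ← he, wt]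
  simp only [mul_pow, inv_pow, div_eq_mul_inv, Int.cast_mul, Int.cast_pow, Int.cast_neg,
    Int.cast_one]
  ring

lemma coeff_triple (f g h : ℕ → PowerSeries ℂ) (a N : ℕ) :
    PowerSeries.coeff a (∑ m ∈ range N, f m * (g m * h m)) =
      ∑ q ∈ antidiagonal a, ∑ q' ∈ antidiagonal q.2, ∑ m ∈ range N,
        PowerSeries.coeff q.1 (f m) *
          (PowerSeries.coeff q'.1 (g m) * PowerSeries.coeff q'.2 (h m)) := by
  rw [map_sum]
  simp only [PowerSeries.coeff_mul, Finset.mul_sum]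
  rw [Finset.sum_comm]
  refine Finset.sum_congr rfl fun q _ => ?_
  rw [Finset.sum_comm]

lemma conv_ps (d : ℕ) (hd : 1 ≤ d) (Y : ℂ) (hY : IsRootOfUnity Y) (hY1 : Y ≠ 1)
    (ε : ℂ) (hε : ε = 1 ∨ ε = -1)
    (A B : ℕ → PowerSeries ℂ) (hA : ∀ a, Good d (fun N => PowerSeries.coeff a (A N)))
    (hB : ∀ a, Good d (fun N => PowerSeries.coeff a (B N))) (a : ℕ) :
    Cvg d (fun N => PowerSeries.coeff a (∑ m ∈ range N,
      (PowerSeries.C (Y ^ (m + 1)) * pinv (ε * ((m + 1 : ℕ) : ℂ))) *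
        (A (N + (m + 1)) * B (N - (m + 1))))) := by
  obtain ⟨e, he, hne⟩ : ∃ e : ℤ, (e : ℂ) = ε ∧ ‖(e : ℂ)‖ = 1 := by
    rcases hε with rfl | rfl
    · exact ⟨1, by simp, by simp⟩
    · exact ⟨-1, by simp, by simp⟩
  have hinv : ε⁻¹ = ε := by rcases hε with rfl | rfl <;> norm_num
  have hε0 : ε ≠ 0 := by rcases hε with rfl | rfl <;> norm_num
  have hcv : Cvg d (∑ q ∈ antidiagonal a, ∑ q' ∈ antidiagonal q.2, (fun N => ∑ m ∈ range N,
        ((((-1) ^ q.1 * e ^ (q.1 + 1) : ℤ) : ℂ) * wt (q.1 + 1, Y) (m + 1)) *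
        ((fun n => PowerSeries.coeff q'.1 (A n)) (N + (m + 1)) *
          (fun n => PowerSeries.coeff q'.2 (B n)) (N - (m + 1))))) := by
    refine Cvg.sum _ _ fun q _ => Cvg.sum _ _ fun q' _ => ?_
    have hn : ‖(((-1) ^ q.1 * e ^ (q.1 + 1) : ℤ) : ℂ)‖ = 1 := by
      rw [Int.cast_mul, Int.cast_pow, Int.cast_pow, norm_mul, norm_pow, norm_pow, hne]
      simp
    exact conv_term d hd Y hY hY1 q.1 ((-1) ^ q.1 * e ^ (q.1 + 1)) hn
        (fun n => PowerSeries.coeff q'.1 (A n)) (fun n => PowerSeries.coeff q'.2 (B n))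
        (hA q'.1) (hB q'.2)
  obtain ⟨l, hl, hlim⟩ := hcv
  refine ⟨l, hl, hlim.congr fun N => ?_⟩
  rw [coeff_triple]
  simp only [Finset.sum_apply]
  refine Finset.sum_congr rfl fun q _ => Finset.sum_congr rfl fun q' _ =>
    Finset.sum_congr rfl fun m _ => ?_
  rw [coeff_YP Y ε e he hinv hε0]

lemma conv_full (d : ℕ) (hd : 1 ≤ d) (Y : ℂ) (hY : IsRootOfUnity Y) (hY1 : Y ≠ 1)
    (A B : ℕ → PowerSeries ℂ) (hA : ∀ a, Good d (fun N => PowerSeries.coeff a (A N)))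
    (hB : ∀ a, Good d (fun N => PowerSeries.coeff a (B N))) (a : ℕ) :
    Cvg d (fun N : ℕ => PowerSeries.coeff a (∑ v ∈ Ioo (-((N : ℤ) + 1)) ((N : ℤ) + 1),
      (PowerSeries.C (Y ^ v) * pinv (-(v : ℂ))) *
        (A ((N : ℤ) + v).toNat * B ((N : ℤ) - v).toNat))) := by
  have h1 := conv_ps d hd Y hY hY1 (-1) (Or.inr rfl) A B hA hB a
  have h2 := conv_ps d hd Y⁻¹ (root_inv hY) (by simpa using hY1) 1 (Or.inl rfl) B A hB hA a
  obtain ⟨l, hl, hlim⟩ := h2.add h1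
  refine ⟨l, hl, hlim.congr fun N => Eq.symm ?_⟩
  rw [sum_Ioo_both, map_add, Pi.add_apply]
  refine congrArg₂ (· + ·) (congrArg _ ?_) (congrArg _ ?_)
  · refine Finset.sum_congr rfl fun m hm => ?_
    rw [Finset.mem_range] at hm
    have e1 : ((N : ℤ) + -((m : ℤ) + 1)).toNat = N - (m + 1) := by omega
    have e2 : ((N : ℤ) - -((m : ℤ) + 1)).toNat = N + (m + 1) := by omega
    have e3 : Y ^ (-((m : ℤ) + 1)) = Y⁻¹ ^ (m + 1) := by
      rw [zpow_neg, inv_pow]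
      norm_cast
    have e4 : -(((-((m : ℤ) + 1) : ℤ)) : ℂ) = 1 * ((m + 1 : ℕ) : ℂ) := by
      push_cast
      ring
    rw [e1, e2, e3, e4, mul_comm (A _)]
  · have e0 : PowerSeries.C (Y ^ (0 : ℤ)) * pinv (-((0 : ℤ) : ℂ)) *
        (A ((N : ℤ) + 0).toNat * B ((N : ℤ) - 0).toNat) = 0 := by
      rw [Int.cast_zero, neg_zero, pinv_zero, mul_zero, zero_mul]
    rw [e0, zero_add]
    refine Finset.sum_congr rfl fun m hm => ?_
    rw [Finset.mem_range] at hm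
    have e1 : ((N : ℤ) - ((m : ℤ) + 1)).toNat = N - (m + 1) := by omega
    have e2 : ((N : ℤ) + ((m : ℤ) + 1)).toNat = N + (m + 1) := by omega
    have e3 : Y ^ ((m : ℤ) + 1) = Y ^ (m + 1) := by norm_cast
    have e4 : -((((m : ℤ) + 1 : ℤ)) : ℂ) = (-1) * ((m + 1 : ℕ) : ℂ) := by
      push_cast
      ring
    rw [e1, e2, e3, e4]

lemma adm_neg (r : ℕ) (κ : ℕ → ℕ) (hκ : ∀ i < r, 0 < κ i) (ξ : ℕ → ℂ)
    (hξ : ∀ i < r, IsRootOfUnity (ξ i)) (h0 : ¬(κ 0 = 1 ∧ ξ 0 = 1)) (i : ℕ) (hi : i ≤ r) :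
    Adm ((List.range' 0 i).map (fun p => (κ p, (ξ p)⁻¹))) := by
  constructor
  · intro p hp
    rw [List.mem_map] at hp
    obtain ⟨n, hn, rfl⟩ := hp
    rw [List.mem_range'_1] at hn
    exact ⟨hκ n (by omega), root_inv (hξ n (by omega))⟩
  · cases i with
    | zero => simp
    | succ i =>
      rw [List.range'_succ]
      intro p hp
      simp only [List.map_cons, List.head?_cons, Option.mem_def, Option.some.injEq] at hp
      subst hp
      simpa using h0

lemma adm_pos (r : ℕ) (κ : ℕ → ℕ) (hκ : ∀ i < r, 0 < κ i) (ξ : ℕ → ℂ)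
    (hξ : ∀ i < r, IsRootOfUnity (ξ i)) (h0 : ¬(κ (r - 1) = 1 ∧ ξ (r - 1) = 1)) (o j : ℕ)
    (hi : o + j = r) :
    Adm ((List.range' o j).map (fun p => (κ p, ξ p))).reverse := by
  constructor
  · intro p hp
    rw [List.mem_reverse, List.mem_map] at hp
    obtain ⟨n, hn, rfl⟩ := hp
    rw [List.mem_range'_1] at hn
    exact ⟨hκ n (by omega), hξ n (by omega)⟩
  · cases j with
    | zero => simp
    | succ j =>
      rw [List.range'_concat]
      intro p hp
      simp only [List.map_append, List.map_cons, List.map_nil, List.reverse_append,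
        List.reverse_singleton, List.singleton_append,
        List.head?_cons, Option.mem_def, Option.some.injEq] at hp
      subst hp
      rw [show r - 1 = o + 1 * j by omega] at h0
      exact h0

lemma core (s : ℕ) (hs : 1 ≤ s) (κ : ℕ → ℕ) (hκ : ∀ i < s + 1, 0 < κ i) (ξ : ℕ → ℂ)
    (hξ : ∀ i < s + 1, IsRootOfUnity (ξ i)) (h0 : ¬(κ 0 = 1 ∧ ξ 0 = 1))
    (h1 : ¬(κ s = 1 ∧ ξ s = 1)) (hX : ∏ i ∈ range (s + 1), ξ i ≠ 1) :
    cmzv ((List.range' 0 (s + 1)).map (fun p => (κ p, ξ p))) +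
      (-1) ^ (((List.range' 0 (s + 1)).map (fun p => (κ p, (ξ p)⁻¹))).map Prod.fst).sum *
        cmzv ((List.range' 0 (s + 1)).map (fun p => (κ p, (ξ p)⁻¹))).reverse ∈ AA s := by
  have hneg : ∀ i N : ℕ, TS (GW κ ξ) i (-((N : ℤ) + 1)) 0
      = QQ (WP (-1)) ((List.range' 0 i).map (fun p => (κ p, (ξ p)⁻¹))) N := by
    intro i N
    rw [← TS_neg]
    simp only [zero_add]
  have gneg : ∀ i ≤ s, ∀ a, Good s (fun N => PowerSeries.coeff a
      (QQ (WP (-1)) ((List.range' 0 i).map (fun p => (κ p, (ξ p)⁻¹))) N)) := by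
    intro i hi a
    exact good_coeff s (-1) (Or.inr rfl) _ (adm_neg (s + 1) κ hκ ξ hξ h0 i (by omega))
      (by simpa using hi) a
  have gpos : ∀ o j, o + j = s + 1 → j ≤ s → ∀ a, Good s (fun N => PowerSeries.coeff a
      (QQ (WP 1) ((List.range' o j).map (fun p => (κ p, ξ p))).reverse N)) := by
    intro o j hoj hj a
    exact good_coeff s 1 (Or.inl rfl) _ (adm_pos (s + 1) κ hκ ξ hξ h1 o j hoj)
      (by simpa using hj) a
  -- the middle part of the first sum
  have c1 : Cvg s (∑ i ∈ range s, fun N => PowerSeries.coeff 0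
      (QQ (WP (-1)) ((List.range' 0 (i + 1)).map (fun p => (κ p, (ξ p)⁻¹))) N *
       QQ (WP 1) ((List.range' (i + 1) (s + 1 - (i + 1))).map (fun p => (κ p, ξ p))).reverse N)) := by
    refine Cvg.sum _ _ fun i hi => Good.cvg ?_
    rw [Finset.mem_range] at hi
    exact good_coeff_mul s _ _ (gneg _ (by omega)) (gpos _ _ (by omega) (by omega)) 0
  have c2 : Cvg s (∑ i ∈ range (s + 1), fun N => PowerSeries.coeff (κ i)
      (QQ (WP (-1)) ((List.range' 0 i).map (fun p => (κ p, (ξ p)⁻¹))) N *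
       QQ (WP 1) ((List.range' (i + 1) (s + 1 - 1 - i)).map (fun p => (κ p, ξ p))).reverse N)) := by
    refine Cvg.sum _ _ fun i hi => Good.cvg ?_
    rw [Finset.mem_range] at hi
    exact good_coeff_mul s _ _ (gneg _ (by omega)) (gpos _ _ (by omega) (by omega)) _
  have c3 : Cvg s (∑ i ∈ range (s + 1), fun N : ℕ => PowerSeries.coeff (κ i - 1)
      (∑ v ∈ Ioo (-((N : ℤ) + 1)) ((N : ℤ) + 1),
      (PowerSeries.C ((∏ i ∈ range (s + 1), ξ i) ^ v) * pinv (-(v : ℂ))) *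
      (QQ (WP (-1)) ((List.range' 0 i).map (fun p => (κ p, (ξ p)⁻¹))) ((N : ℤ) + v).toNat *
       QQ (WP 1) ((List.range' (i + 1) (s + 1 - 1 - i)).map (fun p => (κ p, ξ p))).reverse
        ((N : ℤ) - v).toNat))) := by
    refine Cvg.sum _ _ fun i hi => ?_
    rw [Finset.mem_range] at hi
    exact conv_full s hs _ (root_prod _ _ hξ) hX _ _ (gneg _ (by omega))
      (gpos _ _ (by omega) (by omega)) _
  have r0 := (adm_pos (s + 1) κ hκ ξ hξ h1 0 (s + 1) (by omega)).rate.tendsto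
  rw [List.reverse_reverse] at r0
  have r1 := (adm_neg (s + 1) κ hκ ξ hξ h0 (s + 1) le_rfl).rate.tendsto.const_mul
    ((-1 : ℂ) ^ (((List.range' 0 (s + 1)).map (fun p => (κ p, (ξ p)⁻¹))).map Prod.fst).sum)
  obtain ⟨l, hl, hlim⟩ := (c1.add c2).add c3
  have htot := (r0.add r1).add hlim
  have hseq := htot.congr (f₂ := fun _ => 0) (fun N => by
    have hm := master (s + 1) (Nat.succ_pos s) κ hκ ξ (fun i hi => by
      have := root_norm (hξ i hi)
      intro h
      rw [h] at this
      simp at this) (-((N : ℤ) + 1)) ((N : ℤ) + 1) (by omega) (by omega)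
    have e3 : ∀ i ∈ range (s + 1), (∑ v ∈ Ioo (-((N : ℤ) + 1)) ((N : ℤ) + 1),
        (PowerSeries.C ((∏ p ∈ range (s + 1), ξ p) ^ v) * pinv (-(v : ℂ))) *
          (TS (GW κ ξ) i (-((N : ℤ) + 1) - v) 0 *
            TS (fun p => GW κ ξ (i + 1 + p)) (s + 1 - 1 - i) 0 ((N : ℤ) + 1 - v))) =
        ∑ v ∈ Ioo (-((N : ℤ) + 1)) ((N : ℤ) + 1),
      (PowerSeries.C ((∏ i ∈ range (s + 1), ξ i) ^ v) * pinv (-(v : ℂ))) *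
      (QQ (WP (-1)) ((List.range' 0 i).map (fun p => (κ p, (ξ p)⁻¹))) ((N : ℤ) + v).toNat *
       QQ (WP 1) ((List.range' (i + 1) (s + 1 - 1 - i)).map (fun p => (κ p, ξ p))).reverse
        ((N : ℤ) - v).toNat) := by
      intro i _
      refine Finset.sum_congr rfl fun v hv => ?_
      rw [Finset.mem_Ioo] at hv
      rw [← hneg, ← TS_pos]
      rw [show (-((N : ℤ) + 1) - v) = -((((N : ℤ) + v).toNat : ℤ) + 1) by omega,
        show ((N : ℤ) + 1 - v) = ((((N : ℤ) - v).toNat : ℤ) + 1) by omega]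
    rw [Finset.sum_congr rfl (fun i hi => congrArg (PowerSeries.coeff (κ i - 1)) (e3 i hi))] at hm
    simp only [hneg, TS_pos] at hm
    rw [map_sum, Finset.sum_range_succ, Finset.sum_range_succ'] at hm
    simp only [Nat.sub_self, Nat.sub_zero, List.range'_zero, List.map_nil, List.reverse_nil] at hm
    rw [show ∀ (w : ℕ × ℂ → ℕ → PowerSeries ℂ), QQ w [] N = 1 from fun w => rfl,
      show ∀ (w : ℕ × ℂ → ℕ → PowerSeries ℂ), QQ w [] N = 1 from fun w => rfl, mul_one, one_mul,
      coeff_zero_QQ _ (Or.inl rfl), coeff_zero_QQ _ (Or.inr rfl), one_pow, one_mul] at hm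
    simp only [Pi.add_apply, Finset.sum_apply]
    linear_combination hm)
  have huniq := tendsto_nhds_unique hseq tendsto_const_nhds
  have : cmzv ((List.range' 0 (s + 1)).map (fun p => (κ p, ξ p))) +
      (-1) ^ (((List.range' 0 (s + 1)).map (fun p => (κ p, (ξ p)⁻¹))).map Prod.fst).sum *
        cmzv ((List.range' 0 (s + 1)).map (fun p => (κ p, (ξ p)⁻¹))).reverse = -l := by
    linear_combination huniq
  rw [this]
  exact neg_mem hl

/-- Symmetry of cyclotomic multiple zeta values modulo products of lower depth
(Corollary `main-thm-corone`). -/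
theorem symmetry_cmzv_mod_products (r : ℕ) (hr : 2 ≤ r) (k : ℕ → ℕ) (x : ℕ → ℂ)
    (hk : ∀ i, 1 ≤ i → i ≤ r → 0 < k i)
    (hx : ∀ i, 1 ≤ i → i ≤ r → IsRootOfUnity (x i))
    (h1 : ¬(k 1 = 1 ∧ x 1 = 1)) (hrr : ¬(k r = 1 ∧ x r = 1))
    (hX : (∏ i ∈ Finset.Icc 1 r, x i) ≠ 1) :
    cmzv (List.ofFn fun i : Fin r => (k (i.val + 1), x (i.val + 1)))
      - (-1 : ℂ) ^ ((∑ i ∈ Finset.Icc 1 r, k i) - 1)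
        * cmzv (List.ofFn fun i : Fin r => (k (r - i.val), (x (r - i.val))⁻¹))
    ∈ Subring.closure
        ((Subfield.closure {z : ℂ | IsRootOfUnity z} : Set ℂ)
          ∪ {z : ℂ | ∃ K : List (ℕ × ℂ), K.length ≤ r - 1 ∧
              (∀ p ∈ K, 0 < p.1 ∧ IsRootOfUnity p.2) ∧
              (∀ p ∈ K.getLast?, ¬(p.1 = 1 ∧ p.2 = 1)) ∧ z = cmzv K}) := by
  obtain ⟨s, rfl⟩ : ∃ s, r = s + 1 := ⟨r - 1, by omega⟩
  have hprod : ∏ i ∈ Finset.Icc 1 (s + 1), x i = ∏ i ∈ range (s + 1), x (i + 1) := by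
    rw [Finset.range_eq_Ico, Finset.prod_Ico_add' x 0 (s + 1) 1]
    rfl
  have hsum : ∑ i ∈ Finset.Icc 1 (s + 1), k i = ∑ i ∈ range (s + 1), k (i + 1) := by
    rw [Finset.range_eq_Ico, Finset.sum_Ico_add' k 0 (s + 1) 1]
    rfl
  have h := core s (by omega) (fun i => k (i + 1)) (fun i hi => hk _ (by omega) (by omega))
    (fun i => x (i + 1)) (fun i hi => hx _ (by omega) (by omega)) h1 hrr (by rw [← hprod]; exact hX)
  have e1 : (List.ofFn fun i : Fin (s + 1) => (k (i.val + 1), x (i.val + 1))) =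
      (List.range' 0 (s + 1)).map (fun p => (k (p + 1), x (p + 1))) := by
    apply List.ext_getElem
    · simp
    · intro n h1 h2
      simp only [List.getElem_ofFn, List.getElem_map, List.getElem_range', zero_add, one_mul]
  have e2 : (List.ofFn fun i : Fin (s + 1) => (k (s + 1 - i.val), (x (s + 1 - i.val))⁻¹)) =
      ((List.range' 0 (s + 1)).map (fun p => (k (p + 1), (x (p + 1))⁻¹))).reverse := by
    apply List.ext_getElem
    · simp
    · intro n h1 h2
      simp only [List.length_ofFn] at h1
      simp only [List.getElem_ofFn, List.getElem_reverse, List.getElem_map, List.getElem_range',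
        List.length_map, List.length_range']
      rw [show 0 + 1 * (s + 1 - 1 - n) + 1 = s + 1 - n by omega]
  have e3 : (((List.range' 0 (s + 1)).map (fun p => (k (p + 1), (x (p + 1))⁻¹))).map Prod.fst).sum
      = (∑ i ∈ Finset.Icc 1 (s + 1), k i - 1) + 1 := by
    have hpos : 0 < ∑ i ∈ Finset.Icc 1 (s + 1), k i :=
      lt_of_lt_of_le (hk 1 le_rfl (by omega))
        (Finset.single_le_sum (f := k) (fun i _ => Nat.zero_le _)
          (Finset.mem_Icc.2 ⟨le_rfl, by omega⟩))
    rw [Nat.sub_add_cancel hpos, hsum, List.map_map, ← List.range_eq_range',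
      ← List.sum_toFinset, List.toFinset_range]
    · rfl
    · exact List.nodup_range
  rw [e1, e2]
  rw [e3, pow_succ] at h
  have h' : cmzv ((List.range' 0 (s + 1)).map (fun p => (k (p + 1), x (p + 1))))
      - (-1 : ℂ) ^ ((∑ i ∈ Finset.Icc 1 (s + 1), k i) - 1)
        * cmzv ((List.range' 0 (s + 1)).map (fun p => (k (p + 1), (x (p + 1))⁻¹))).reverse
      ∈ AA s := by
    convert h using 1
    ring
  exact h'
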